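/- arXiv:1607.06597 — 5 statements merged into one kernel-verified Lean document; each statement's English description precedes it below -/
import Mathlib

section
/- Let s > 0 with s ≠ 1, and let θ₁, θ₂, θ₃, θ₄ ∈ ℝ be such that the four points pᵢ = (cos θᵢ, s·sin θᵢ) on the ellipse x² + (y/s)² = 1 are pairwise distinct. Then p₁, p₂, p₃, p₄ lie on a common circle if and only if θ₁ + θ₂ + θ₃ + θ₄ ≡ 0 (mod 2π). -/
noncomputable section

/-- A circle in the plane `ℝ² ≅ ℂ`: the set of points at a fixed positive
distance from a fixed centre. -/
def IsCircle (s : Set ℂ) : Prop :=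
  ∃ (c : ℂ) (ρ : ℝ), 0 < ρ ∧ s = Metric.sphere c ρ

/-- A line in the plane `ℝ² ≅ ℂ`. -/
def IsLine (s : Set ℂ) : Prop :=
  ∃ a d : ℂ, d ≠ 0 ∧ s = {z : ℂ | ∃ t : ℝ, z = a + t • d}

/-- A generalised circle is a circle or a line. -/
def IsGenCircle (s : Set ℂ) : Prop :=
  IsCircle s ∨ IsLine s

/-- The number of ordinary circles of a planar point set `P`:
circles containing exactly three points of `P`. -/
def ordinaryCircles (P : Set ℂ) : ℕ :=
  {C : Set ℂ | IsCircle C ∧ (C ∩ P).ncard = 3}.ncard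

/-- The number of ordinary generalised circles of a planar point set `P`:
generalised circles containing exactly three points of `P`. -/
def ordinaryGenCircles (P : Set ℂ) : ℕ :=
  {C : Set ℂ | IsGenCircle C ∧ (C ∩ P).ncard = 3}.ncard

/-- The number of 4-point generalised circles of a planar point set `P`:
generalised circles containing exactly four points of `P`. -/
def fourPointGenCircles (P : Set ℂ) : ℕ :=
  {C : Set ℂ | IsGenCircle C ∧ (C ∩ P).ncard = 4}.ncard

open ComplexConjugate in
/-- A quartic self-inversive polynomial, evaluated at a point of the unit circle,
is governed by a real trigonometric expression. -/
theorem quartic_eq_zero_of_trig {α z : ℂ} {β : ℝ} (hz : z * conj z = 1)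
    (h : 2 * (z.re ^ 2 - z.im ^ 2) + 2 * (α.re * z.re - α.im * z.im) + β = 0) :
    z ^ 4 + α * z ^ 3 + β * z ^ 2 + conj α * z + 1 = 0 := by
  have key : z ^ 2 + α * z + β + conj α * conj z + (conj z) ^ 2 = 0 := by
    apply Complex.ext
    · simp [pow_two]
      linarith
    · simp [pow_two]
      ring
  linear_combination z ^ 2 * key - (conj α * z + z * conj z + 1) * hz

/-- The product of four distinct roots of a monic quartic is its constant coefficient. -/
theorem prod_roots_quartic {K : Type*} [Field K] {α β γ δ a b c d : K}
    (ha : a ^ 4 + α * a ^ 3 + β * a ^ 2 + γ * a + δ = 0)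
    (hb : b ^ 4 + α * b ^ 3 + β * b ^ 2 + γ * b + δ = 0)
    (hc : c ^ 4 + α * c ^ 3 + β * c ^ 2 + γ * c + δ = 0)
    (hd : d ^ 4 + α * d ^ 3 + β * d ^ 2 + γ * d + δ = 0)
    (hab : a ≠ b) (hac : a ≠ c) (had : a ≠ d) (hbc : b ≠ c) (hbd : b ≠ d) (hcd : c ≠ d) :
    a * b * c * d = δ := by
  have first {x : K} (hx : x ^ 4 + α * x ^ 3 + β * x ^ 2 + γ * x + δ = 0) (hax : a ≠ x) :
      a ^ 3 + a ^ 2 * x + a * x ^ 2 + x ^ 3 + α * (a ^ 2 + a * x + x ^ 2)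
        + β * (a + x) + γ = 0 := by
    apply mul_left_cancel₀ (sub_ne_zero.mpr hax)
    linear_combination ha - hx
  have second {x : K} (hx : x ^ 4 + α * x ^ 3 + β * x ^ 2 + γ * x + δ = 0) (hax : a ≠ x)
      (hbx : b ≠ x) :
      a ^ 2 + b ^ 2 + x ^ 2 + a * b + a * x + b * x + α * (a + b + x) + β = 0 := by
    apply mul_left_cancel₀ (sub_ne_zero.mpr hbx)
    linear_combination first hb hab - first hx hax
  have third : a + b + c + d + α = 0 := by
    apply mul_left_cancel₀ (sub_ne_zero.mpr hcd)
    linear_combination second hc hac hbc - second hd had hbd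
  linear_combination -ha + a * first hb hab - a * b * second hc hac hbc + a * b * c * third

open ComplexConjugate in
/-- For four points of the unit circle with product `1`, the trigonometric form of the
vanishing of `∏ (X - zᵢ)` at one of them. -/
theorem trig_eq_zero_of_prod_eq_one {a b c d e f : ℂ} (ha : a * conj a = 1) (hb : b * conj b = 1)
    (hc : c * conj c = 1) (hd : d * conj d = 1) (h : a * b * c * d = 1)
    (he : e = a + b + c + d) (hf : f = a * b + a * c + a * d + b * c + b * d + c * d) :
    2 * (a.re ^ 2 - a.im ^ 2)
      - 2 * (e.re * a.re - e.im * a.im) + f.re = 0 := by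
  have pair {x y u v : ℂ} (hx : x * conj x = 1) (hy : y * conj y = 1)
      (hxy : x * y * (u * v) = 1) : conj x * conj y = u * v := by
    linear_combination (-conj x * conj y) * hxy + (y * conj y * u * v) * hx + (u * v) * hy
  have hab : conj a * conj b = c * d := pair ha hb (by linear_combination h)
  have hac : conj a * conj c = b * d := pair ha hc (by linear_combination h)
  have had : conj a * conj d = b * c := pair ha hd (by linear_combination h)
  have key : a ^ 2 + (conj a) ^ 2 - e * a - conj e * conj a + f = 0 := by
    simp only [he, hf, map_add]
    linear_combination -hab - hac - had
  have hre := congrArg Complex.re key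
  simp [pow_two] at hre ⊢
  linarith

/-- Completing the square in the equation of a circle restricted to the ellipse. -/
theorem ellipse_circle_identity {s x y u v : ℝ} (h : x ^ 2 + y ^ 2 = 1) :
    4 * ((x - u) ^ 2 + (s * y - v) ^ 2) =
      (1 - s ^ 2) * (2 * (x ^ 2 - y ^ 2)) - 8 * u * x - 8 * s * v * y
        + 2 * (1 + s ^ 2) + 4 * (u ^ 2 + v ^ 2) := by
  linear_combination 2 * (1 + s ^ 2) * h

/-- Four pairwise distinct points `(cos θᵢ, s·sin θᵢ)` on the ellipse `x² + (y/s)² = 1`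
are concyclic if and only if `θ₁ + θ₂ + θ₃ + θ₄ ≡ 0 (mod 2π)`. -/
theorem concyclic_on_ellipse_iff (s : ℝ) (hs : 0 < s) (hs1 : s ≠ 1)
    (θ : Fin 4 → ℝ) (p : Fin 4 → ℂ)
    (hp : ∀ i, p i = ⟨Real.cos (θ i), s * Real.sin (θ i)⟩)
    (hdist : ∀ i j, i ≠ j → p i ≠ p j) :
    (∃ C : Set ℂ, IsCircle C ∧ ∀ i, p i ∈ C) ↔
      ∃ k : ℤ, θ 0 + θ 1 + θ 2 + θ 3 = 2 * Real.pi * (k : ℝ) := by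
  have hD : 1 - s ^ 2 ≠ 0 := by
    intro h
    exact hs1 ((sq_eq_sq₀ hs.le zero_le_one).mp (by linarith))
  set z : Fin 4 → ℂ := fun i => Complex.exp (θ i * Complex.I) with hz
  have hre (i) : (z i).re = Real.cos (θ i) := Complex.exp_ofReal_mul_I_re _
  have him (i) : (z i).im = Real.sin (θ i) := Complex.exp_ofReal_mul_I_im _
  have hunit (i) : z i * (starRingEnd ℂ) (z i) = 1 := by
    simp [Complex.mul_conj, Complex.normSq_eq_norm_sq, hz, Complex.norm_exp_ofReal_mul_I]
  have hone (i) : (z i).re ^ 2 + (z i).im ^ 2 = 1 := by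
    rw [hre, him, Real.cos_sq_add_sin_sq]
  have hz_ne (i j) (hij : i ≠ j) : z i ≠ z j := by
    intro h
    apply hdist i j hij
    rw [hp, hp, ← hre, ← hre, ← him, ← him, h]
  have hdist_sq (i) (c : ℂ) :
      dist (p i) c ^ 2 = ((z i).re - c.re) ^ 2 + (s * (z i).im - c.im) ^ 2 := by
    rw [Complex.dist_eq_re_im, Real.sq_sqrt (by positivity), hp, hre, him]
  have hsum : (∃ k : ℤ, θ 0 + θ 1 + θ 2 + θ 3 = 2 * Real.pi * (k : ℝ)) ↔
      z 0 * z 1 * z 2 * z 3 = 1 := by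
    simp only [hz, ← Complex.exp_add, ← add_mul, Complex.exp_eq_one_iff]
    refine exists_congr fun k => ?_
    rw [← mul_assoc, mul_left_inj' Complex.I_ne_zero, mul_comm (k : ℂ)]
    norm_cast
  rw [hsum]
  constructor
  · rintro ⟨_, ⟨c, ρ, -, rfl⟩, hmem⟩
    have root (i) := quartic_eq_zero_of_trig (z := z i)
      (α := ⟨-4 * c.re / (1 - s ^ 2), 4 * s * c.im / (1 - s ^ 2)⟩)
      (β := (2 * (1 + s ^ 2) + 4 * (c.re ^ 2 + c.im ^ 2 - ρ ^ 2)) / (1 - s ^ 2)) (hunit i) (by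
        have h := hdist_sq i c
        rw [Metric.mem_sphere.mp (hmem i)] at h
        have h' := ellipse_circle_identity (s := s) (u := c.re) (v := c.im) (hone i)
        field_simp
        linear_combination -4 * h - h')
    exact prod_roots_quartic (root 0) (root 1) (root 2) (root 3)
      (hz_ne _ _ (by decide)) (hz_ne _ _ (by decide)) (hz_ne _ _ (by decide))
      (hz_ne _ _ (by decide)) (hz_ne _ _ (by decide)) (hz_ne _ _ (by decide))
  · intro h
    set e := z 0 + z 1 + z 2 + z 3 with he
    set f := z 0 * z 1 + z 0 * z 2 + z 0 * z 3 + z 1 * z 2 + z 1 * z 3 + z 2 * z 3 with hf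
    have trig (i) : 2 * ((z i).re ^ 2 - (z i).im ^ 2)
        - 2 * (e.re * (z i).re - e.im * (z i).im) + f.re = 0 := by
      fin_cases i
      · exact trig_eq_zero_of_prod_eq_one (hunit 0) (hunit 1) (hunit 2) (hunit 3)
          h he hf
      · exact trig_eq_zero_of_prod_eq_one (a := z 1) (hunit 1) (hunit 0) (hunit 2) (hunit 3)
          (by linear_combination h) (by rw [he]; ring) (by rw [hf]; ring)
      · exact trig_eq_zero_of_prod_eq_one (a := z 2) (hunit 2) (hunit 0) (hunit 1) (hunit 3)
          (by linear_combination h) (by rw [he]; ring) (by rw [hf]; ring)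
      · exact trig_eq_zero_of_prod_eq_one (a := z 3) (hunit 3) (hunit 0) (hunit 1) (hunit 2)
          (by linear_combination h) (by rw [he]; ring) (by rw [hf]; ring)
    let c : ℂ := ⟨(1 - s ^ 2) * e.re / 4, -((1 - s ^ 2) * e.im / (4 * s))⟩
    have hconst (i) : 4 * dist (p i) c ^ 2 =
        -(1 - s ^ 2) * f.re + 2 * (1 + s ^ 2) + 4 * (c.re ^ 2 + c.im ^ 2) := by
      have hu : 4 * c.re = (1 - s ^ 2) * e.re := by simp only [c]; ring
      have hv : 4 * s * c.im = -((1 - s ^ 2) * e.im) := by simp only [c]; field_simp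
      rw [hdist_sq, ellipse_circle_identity (hone i)]
      linear_combination (1 - s ^ 2) * trig i - 2 * (z i).re * hu - 2 * (z i).im * hv
    have hequi (i) : dist (p i) c = dist (p 0) c := by
      rw [← sq_eq_sq₀ dist_nonneg dist_nonneg]
      linarith [hconst i, hconst 0]
    refine ⟨_, ⟨c, dist (p 0) c, dist_pos.mpr fun h0 => ?_, rfl⟩, hequi⟩
    have h1 := hequi 1
    rw [h0, dist_self, dist_eq_zero] at h1
    exact hdist 0 1 (by decide) (h0.trans h1.symm)
end
end

section
/- There is an absolute constant c such that the following holds: for every K > 0 there exists N such that for every abelian group G, every integer n ≥ N, and all finite subsets A, B, C of G whose cardinalities each differ from n by at most K, if there are at most Kn pairs (a,b) ∈ A × B with a + b ∉ C, then there exist a finite subgroup H of G and elements x, y ∈ G such that |A △ (H + x)| ≤ cK, |B △ (H + y)| ≤ cK, and |C △ (H + x + y)| ≤ cK. -/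
open Finset Pointwise

/-- If the sets `T s`, `s ∈ S`, all have at least `t` elements and embed disjointly in `E`,
then `#S * t ≤ #E`. -/
lemma card_mul_le_card_of_fibers {α β γ : Type*} (E : Finset α) (S : Finset β)
    (T : β → Finset γ) (g : β → γ → α) (t : ℝ)
    (hg : ∀ s s' x x', g s x = g s' x' → s = s' ∧ x = x')
    (hE : ∀ s ∈ S, ∀ x ∈ T s, g s x ∈ E) (ht : ∀ s ∈ S, t ≤ #(T s)) :
    #S * t ≤ #E := by
  have hcard : #(S.sigma T) ≤ #E := by
    refine card_le_card_of_injOn (fun p => g p.1 p.2) ?_ ?_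
    · rintro ⟨s, x⟩ hp
      have hp := mem_sigma.1 (mem_coe.1 hp)
      exact hE s hp.1 x hp.2
    · rintro ⟨s, x⟩ - ⟨s', x'⟩ - h
      obtain ⟨rfl, rfl⟩ := hg _ _ _ _ h
      rfl
  calc (#S : ℝ) * t = ∑ _s ∈ S, t := by simp
    _ ≤ ∑ s ∈ S, (#(T s) : ℝ) := sum_le_sum ht
    _ = (#(S.sigma T) : ℝ) := by simp [card_sigma]
    _ ≤ #E := by exact_mod_cast hcard

/-- Inclusion-exclusion lower bound for the size of an intersection. -/
lemma card_add_card_sub_le_card_inter {α : Type*} [DecidableEq α] {U V W : Finset α}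
    (hU : U ⊆ W) (hV : V ⊆ W) : (#U : ℝ) + #V - #W ≤ #(U ∩ V) := by
  have h₁ := card_union_add_card_inter U V
  have h₂ := card_le_card (union_subset hU hV)
  have : #U + #V ≤ #(U ∩ V) + #W := by omega
  have : (#U : ℝ) + #V ≤ #(U ∩ V) + #W := by exact_mod_cast this
  linarith

/-- A set with fewer than `3/2 * #A` differences has a subgroup as its difference set. -/
lemma exists_addSubgroup_coe_eq_sub {G : Type*} [AddCommGroup G] [DecidableEq G]
    {A : Finset G} (hA : A.Nonempty) (h : (#(A - A) : ℝ) < 3 / 2 * #A) :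
    ∃ H : AddSubgroup G, (H : Set G) = ((A - A : Finset G) : Set G) := by
  have key : ∀ d ∈ A - A, (#A : ℝ) / 2 < #{p ∈ A | p - d ∈ A} := by
    intro d hd
    obtain ⟨a, ha, b, hb, rfl⟩ := mem_sub.1 hd
    have hsub : ∀ c ∈ A, A.image (c - ·) ⊆ A - A := by
      intro c hc z hz
      obtain ⟨p, hp, rfl⟩ := mem_image.1 hz
      exact sub_mem_sub hc hp
    have hcard : ∀ c, #(A.image (c - ·)) = #A := fun c =>
      card_image_of_injective _ fun p q => by simp
    have h₁ := card_add_card_sub_le_card_inter (hsub a ha) (hsub b hb)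
    rw [hcard, hcard] at h₁
    have h₂ : #(A.image (a - ·) ∩ A.image (b - ·)) ≤ #{p ∈ A | p - (a - b) ∈ A} := by
      refine card_le_card_of_injOn (a - ·) ?_ fun p _ q _ => by simp
      intro z hz
      obtain ⟨h₁, h₂⟩ := mem_inter.1 (mem_coe.1 hz)
      obtain ⟨p, hp, rfl⟩ := mem_image.1 h₁
      obtain ⟨q, hq, hpq⟩ := mem_image.1 h₂
      have : p - (a - b) = q := by
        rw [sub_eq_iff_eq_add] at hpq
        rw [eq_add_of_sub_eq (a := b) (b := q) (c := a - p) (by rw [hpq]; abel)]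
        abel
      simp [hp, this, hq]
    have h₃ : (#(A.image (a - ·) ∩ A.image (b - ·)) : ℝ) ≤ #{p ∈ A | p - (a - b) ∈ A} := by
      exact_mod_cast h₂
    linarith
  have hneg : ∀ d ∈ A - A, -d ∈ A - A := by
    intro d hd
    obtain ⟨a, ha, b, hb, rfl⟩ := mem_sub.1 hd
    rw [neg_sub]
    exact sub_mem_sub hb ha
  refine ⟨⟨⟨⟨((A - A : Finset G) : Set G), ?_⟩, ?_⟩, ?_⟩, rfl⟩
  · intro u v hu hv
    have hu := mem_coe.1 hu
    have hv := mem_coe.1 hv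
    have h₁ := card_add_card_sub_le_card_inter (filter_subset (fun p => p - u ∈ A) A)
      (filter_subset (fun p => p - -v ∈ A) A)
    have h₂ := key u hu
    have h₃ := key (-v) (hneg v hv)
    have hpos : (0 : ℝ) < #({p ∈ A | p - u ∈ A} ∩ {p ∈ A | p - -v ∈ A}) := by linarith
    obtain ⟨p, hp⟩ := card_pos.1 (by exact_mod_cast hpos)
    simp only [mem_inter, mem_filter] at hp
    have := sub_mem_sub hp.2.2 hp.1.2
    rw [show p - -v - (p - u) = u + v by abel] at this
    exact mem_coe.2 this
  · obtain ⟨a, ha⟩ := hA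
    have := sub_mem_sub ha ha
    rw [sub_self] at this
    exact mem_coe.2 this
  · intro d hd
    exact mem_coe.2 (hneg d (mem_coe.1 hd))

/-- The symmetric difference of a finite set with a translate, in terms of the intersection. -/
lemma ncard_symmDiff_translate {G : Type*} [AddCommGroup G] [DecidableEq G]
    (A D : Finset G) (x : G) :
    ((symmDiff (A : Set G) ((· + x) '' (D : Set G))).ncard : ℝ) =
      #A + #D - 2 * #{a ∈ A | a - x ∈ D} := by
  have hX : #(D.image (· + x)) = #D := card_image_of_injective _ (add_left_injective x)
  have hinter : A ∩ D.image (· + x) = {a ∈ A | a - x ∈ D} := by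
    ext a
    simp [← sub_eq_add_neg]
  have hset : symmDiff (A : Set G) ((· + x) '' (D : Set G)) =
      ((symmDiff A (D.image (· + x)) : Finset G) : Set G) := by
    rw [coe_symmDiff, coe_image]
  rw [hset, Set.ncard_coe_finset, symmDiff_def, sup_eq_union,
    card_union_of_disjoint disjoint_sdiff_sdiff, ← hinter, ← hX]
  have h₁ := card_sdiff_add_card_inter A (D.image (· + x))
  have h₂ := card_sdiff_add_card_inter (D.image (· + x)) A
  rw [inter_comm] at h₂
  have h₁ : (#(A \ D.image (· + x)) : ℝ) + #(A ∩ D.image (· + x)) = #A := by exact_mod_cast h₁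
  have h₂ : (#(D.image (· + x) \ A) : ℝ) + #(A ∩ D.image (· + x)) = #(D.image (· + x)) := by
    exact_mod_cast h₂
  push_cast
  linarith

/-- Splitting a finite set by a predicate, with real cardinalities. -/
lemma card_filter_add_card_filter_not_real {α : Type*} (S : Finset α) (p : α → Prop)
    [DecidablePred p] : (#{a ∈ S | p a} : ℝ) + #{a ∈ S | ¬ p a} = #S := by
  exact_mod_cast card_filter_add_card_filter_not (s := S) p

section AlmostClosed

variable {G : Type*} [AddCommGroup G] [DecidableEq G] {A B C : Finset G} {K n : ℝ}

/-- If `A + B` is almost contained in `C`, then most of `A` lies in a coset of a subgroup which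
is not much larger than `A`. -/
lemma exists_addSubgroup_of_almost_closed (hK : 0 < K) (hn : 1000 * K ≤ n)
    (hA : |(#A : ℝ) - n| ≤ K) (hB : |(#B : ℝ) - n| ≤ K) (hC : |(#C : ℝ) - n| ≤ K)
    (hE : (#{p ∈ A ×ˢ B | p.1 + p.2 ∉ C} : ℝ) ≤ K * n) :
    ∃ (H : AddSubgroup G) (D : Finset G) (x : G), (H : Set G) = (D : Set G) ∧
      (#D : ℝ) ≤ 6 / 5 * n ∧ n - 21 * K ≤ #D ∧ n - 21 * K ≤ #{a ∈ A | a - x ∈ D} := by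
  rw [abs_le] at hA hB hC
  have hn0 : 0 < n := by linarith
  set bad : G → Finset G := fun a => {b ∈ B | a + b ∉ C}
  set A' : Finset G := {a ∈ A | (#(bad a) : ℝ) < n / 20}
  have hcompl : (#{a ∈ A | ¬ (#(bad a) : ℝ) < n / 20} : ℝ) * (n / 20) ≤ K * n := by
    refine le_trans (card_mul_le_card_of_fibers _ _ bad (fun a b => (a, b)) _ ?_ ?_ ?_) hE
    · simp
    · intro a ha b hb
      have ha := (mem_filter.1 ha).1
      have hb := mem_filter.1 hb
      simp [ha, hb]
    · intro a ha
      exact not_lt.1 (mem_filter.1 ha).2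
  have hcompl : (#{a ∈ A | ¬ (#(bad a) : ℝ) < n / 20} : ℝ) ≤ 20 * K := by
    refine le_of_mul_le_mul_right ?_ (show 0 < n / 20 by linarith)
    linarith
  have hA'card : n - 21 * K ≤ #A' := by
    have := card_filter_add_card_filter_not_real A (fun a => (#(bad a) : ℝ) < n / 20)
    linarith
  have hA'ne : A'.Nonempty := by
    rw [← card_pos]
    have : (0 : ℝ) < #A' := by linarith
    exact_mod_cast this
  have hdiff : (#(A' - A') : ℝ) * (9 / 10 * n - 3 * K) ≤ #(B ×ˢ B) := by
    refine card_mul_le_card_of_fibers _ _ (fun d => {b ∈ B | b - d ∈ B})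
      (fun d b => (b, b - d)) _ ?_ ?_ ?_
    · intro d d' b b' h
      simp only [Prod.mk.injEq] at h
      obtain ⟨rfl, h⟩ := h
      exact ⟨sub_right_injective h, rfl⟩
    · intro d _ b hb
      simpa using hb
    · intro d hd
      obtain ⟨a, ha, a', ha', rfl⟩ := mem_sub.1 hd
      have hgood : ∀ a ∈ A', n - K - n / 20 ≤ #({b ∈ B | a + b ∈ C}.image (a + ·)) := by
        intro a ha
        rw [card_image_of_injective _ (add_right_injective a)]
        have h₁ := card_filter_add_card_filter_not_real B (fun b => a + b ∈ C)
        have h₂ : (#{b ∈ B | a + b ∉ C} : ℝ) < n / 20 := (mem_filter.1 ha).2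
        linarith
      have hsub : ∀ a, {b ∈ B | a + b ∈ C}.image (a + ·) ⊆ C := by
        intro a z hz
        obtain ⟨b, hb, rfl⟩ := mem_image.1 hz
        exact (mem_filter.1 hb).2
      have h₁ := card_add_card_sub_le_card_inter (hsub a) (hsub a')
      have h₂ : #({b ∈ B | a + b ∈ C}.image (a + ·) ∩ {b ∈ B | a' + b ∈ C}.image (a' + ·)) ≤
          #{b ∈ B | b - (a - a') ∈ B} := by
        refine card_le_card_of_injOn (· - a') ?_ fun p _ q _ => by simp
        intro z hz
        obtain ⟨h₁, h₂⟩ := mem_inter.1 (mem_coe.1 hz)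
        obtain ⟨b, hb, rfl⟩ := mem_image.1 h₁
        obtain ⟨b', hb', hbb⟩ := mem_image.1 h₂
        simp only [mem_filter] at hb hb'
        have e₁ : a + b - a' = b' := by
          rw [← hbb]
          abel
        have e₂ : b' - (a - a') = b := by
          rw [← e₁]
          abel
        simp [e₁, e₂, hb.1, hb'.1]
      have h₂ : (#({b ∈ B | a + b ∈ C}.image (a + ·) ∩ {b ∈ B | a' + b ∈ C}.image (a' + ·)) : ℝ)
          ≤ #{b ∈ B | b - (a - a') ∈ B} := by exact_mod_cast h₂
      linarith [hgood a ha, hgood a' ha']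
  have hBB : (#(B ×ˢ B) : ℝ) ≤ (n + K) * (n + K) := by
    rw [card_product]
    push_cast
    have : (#B : ℝ) ≤ n + K := by linarith
    gcongr
  have hD : (#(A' - A') : ℝ) ≤ 6 / 5 * n := by
    by_contra! h
    nlinarith
  obtain ⟨H, hH⟩ := exists_addSubgroup_coe_eq_sub hA'ne (by linarith)
  obtain ⟨x, hx⟩ := hA'ne
  refine ⟨H, A' - A', x, hH, hD, hA'card.trans ?_, hA'card.trans ?_⟩
  · exact_mod_cast card_le_card_of_injOn (· - x)
      (fun a ha => mem_coe.2 (sub_mem_sub (mem_coe.1 ha) hx)) fun p _ q _ => by simp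
  · exact_mod_cast card_le_card fun a ha =>
      mem_filter.2 ⟨(mem_filter.1 ha).1, sub_mem_sub ha hx⟩

/-- Quantitative form for a single triple of sets: they are close to cosets of a subgroup. -/
lemma exists_cosets_of_almost_closed (hK : 0 < K) (hn : 1000 * K ≤ n)
    (hA : |(#A : ℝ) - n| ≤ K) (hB : |(#B : ℝ) - n| ≤ K) (hC : |(#C : ℝ) - n| ≤ K)
    (hE : (#{p ∈ A ×ˢ B | p.1 + p.2 ∉ C} : ℝ) ≤ K * n) :
    ∃ (H : AddSubgroup G) (D : Finset G) (x y : G), (H : Set G) = (D : Set G) ∧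
      (#A : ℝ) + #D - 2 * #{a ∈ A | a - x ∈ D} ≤ 50 * K ∧
      (#B : ℝ) + #D - 2 * #{b ∈ B | b - y ∈ D} ≤ 50 * K ∧
      (#C : ℝ) + #D - 2 * #{c ∈ C | c - (x + y) ∈ D} ≤ 50 * K := by
  obtain ⟨H, D, x, hH, hD, hD', hA₁⟩ := exists_addSubgroup_of_almost_closed hK hn hA hB hC hE
  have hmem : ∀ z, z ∈ D ↔ z ∈ H := fun z => by
    rw [← mem_coe, ← hH, SetLike.mem_coe]
  rw [abs_le] at hA hB hC
  have hn0 : 0 < n := by linarith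
  set A₁ : Finset G := {a ∈ A | a - x ∈ D}
  obtain ⟨y, hy, hybad⟩ : ∃ y ∈ B, (#{a ∈ A | a + y ∉ C} : ℝ) < 2 * K := by
    by_contra! h
    have : (#B : ℝ) * (2 * K) ≤ K * n := by
      refine le_trans (card_mul_le_card_of_fibers _ _ (fun b => {a ∈ A | a + b ∉ C})
        (fun b a => (a, b)) _ ?_ ?_ h) hE
      · simp +contextual
      · intro b hb a ha
        have ha := mem_filter.1 ha
        simp [hb, ha]
    nlinarith
  set B₁ : Finset G := {b ∈ B | b - y ∈ D}
  set C₁ : Finset G := {c ∈ C | c - (x + y) ∈ D}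
  have hC₁ : n - 23 * K ≤ #C₁ := by
    have h₁ := card_filter_add_card_filter_not_real A₁ (fun a => a + y ∈ C)
    have h₂ : #{a ∈ A₁ | a + y ∉ C} ≤ #{a ∈ A | a + y ∉ C} :=
      card_le_card (filter_subset_filter _ (filter_subset _ _))
    have h₃ : #{a ∈ A₁ | a + y ∈ C} ≤ #C₁ := by
      refine card_le_card_of_injOn (· + y) ?_ fun p _ q _ => by simp
      intro a ha
      have ha := mem_filter.1 (mem_coe.1 ha)
      refine mem_coe.2 (mem_filter.2 ⟨ha.2, ?_⟩)
      rw [add_sub_add_right_eq_sub]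
      exact (mem_filter.1 ha.1).2
    have h₂ : (#{a ∈ A₁ | a + y ∉ C} : ℝ) ≤ #{a ∈ A | a + y ∉ C} := by exact_mod_cast h₂
    have h₃ : (#{a ∈ A₁ | a + y ∈ C} : ℝ) ≤ #C₁ := by exact_mod_cast h₃
    linarith
  have hCsplit := card_filter_add_card_filter_not_real C (fun c => c - (x + y) ∈ D)
  have hBsplit := card_filter_add_card_filter_not_real B (fun b => b - y ∈ D)
  have hBout : (#{b ∈ B | b - y ∉ D} : ℝ) * (n / 2) ≤ K * n := by
    refine le_trans (card_mul_le_card_of_fibers _ _ (fun b => {a ∈ A₁ | a + b ∉ C})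
      (fun b a => (a, b)) _ ?_ ?_ ?_) hE
    · simp +contextual
    · intro b hb a ha
      have hb := mem_filter.1 hb
      have ha := mem_filter.1 ha
      simp [hb, ha, (mem_filter.1 ha.1).1]
    · intro b hb
      have h₁ := card_filter_add_card_filter_not_real A₁ (fun a => a + b ∈ C)
      have h₂ : #{a ∈ A₁ | a + b ∈ C} ≤ #{c ∈ C | c - (x + y) ∉ D} := by
        refine card_le_card_of_injOn (· + b) ?_ fun p _ q _ => by simp
        intro a ha
        have ha := mem_filter.1 (mem_coe.1 ha)
        refine mem_coe.2 (mem_filter.2 ⟨ha.2, fun h => (mem_filter.1 hb).2 ?_⟩)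
        have hax := (mem_filter.1 ha.1).2
        rw [hmem] at h hax ⊢
        have := H.sub_mem h hax
        rwa [show a + b - (x + y) - (a - x) = b - y by abel] at this
      have h₂ : (#{a ∈ A₁ | a + b ∈ C} : ℝ) ≤ #{c ∈ C | c - (x + y) ∉ D} := by
        exact_mod_cast h₂
      linarith
  have hBout : (#{b ∈ B | b - y ∉ D} : ℝ) ≤ 2 * K := by
    by_contra! h
    nlinarith
  have hDout : (#{h ∈ D | h + (x + y) ∉ C} : ℝ) * (n / 2) ≤ K * n := by
    refine le_trans (card_mul_le_card_of_fibers _ _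
      (fun h => A₁.image (· - x) ∩ B₁.image (h + y - ·))
      (fun h u => (u + x, h + y - u)) _ ?_ ?_ ?_) hE
    · intro h h' u u' e
      simp only [Prod.mk.injEq, add_left_inj] at e
      obtain ⟨rfl, e⟩ := e
      exact ⟨by simpa using e, rfl⟩
    · intro h hh u hu
      obtain ⟨h₁, h₂⟩ := mem_inter.1 hu
      obtain ⟨a, ha, rfl⟩ := mem_image.1 h₁
      obtain ⟨b, hb, hba⟩ := mem_image.1 h₂
      have hb' : h + y - (a - x) = b := by
        rw [← hba]
        abel
      have hsum : a + b = h + (x + y) := by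
        rw [← hb']
        abel
      simp only [hb', sub_add_cancel, mem_filter, mem_product, hsum]
      exact ⟨⟨(mem_filter.1 ha).1, (mem_filter.1 hb).1⟩, (mem_filter.1 hh).2⟩
    · intro h hh
      have hU : A₁.image (· - x) ⊆ D := by
        intro z hz
        obtain ⟨a, ha, rfl⟩ := mem_image.1 hz
        exact (mem_filter.1 ha).2
      have hV : B₁.image (h + y - ·) ⊆ D := by
        intro z hz
        obtain ⟨b, hb, rfl⟩ := mem_image.1 hz
        have hby := (mem_filter.1 hb).2
        have hh := (mem_filter.1 hh).1
        rw [hmem] at hby hh ⊢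
        rw [show h + y - b = h - (b - y) by abel]
        exact H.sub_mem hh hby
      have h₁ := card_add_card_sub_le_card_inter hU hV
      rw [card_image_of_injective _ fun p q => by simp,
        card_image_of_injective _ fun p q => by simp] at h₁
      linarith
  have hDout : (#{h ∈ D | h + (x + y) ∉ C} : ℝ) ≤ 2 * K := by
    by_contra! h
    nlinarith
  have hDsplit := card_filter_add_card_filter_not_real D (fun h => h + (x + y) ∈ C)
  have hDin : #{h ∈ D | h + (x + y) ∈ C} ≤ #C₁ := by
    refine card_le_card_of_injOn (· + (x + y)) ?_ fun p _ q _ => by simp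
    intro h hh
    have hh := mem_filter.1 (mem_coe.1 hh)
    refine mem_coe.2 (mem_filter.2 ⟨hh.2, ?_⟩)
    rw [add_sub_cancel_right]
    exact hh.1
  have hDin : (#{h ∈ D | h + (x + y) ∈ C} : ℝ) ≤ #C₁ := by exact_mod_cast hDin
  have hC₁le : (#C₁ : ℝ) ≤ #C := by exact_mod_cast card_filter_le _ _
  exact ⟨H, D, x, y, hH, by linarith, by linarith, by linarith⟩

end AlmostClosed

/-- Green–Tao Proposition A.5: three finite subsets of an abelian group, each of size
roughly `n`, that are almost closed under pairwise addition, are close to cosets of a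
common finite subgroup. -/
theorem almost_group_three_sets :
    ∃ c : ℝ, ∀ K : ℝ, 0 < K → ∃ N : ℕ,
      ∀ (G : Type) (_ : AddCommGroup G), ∀ n : ℕ, N ≤ n →
      ∀ A B C : Finset G,
        |(A.card : ℝ) - (n : ℝ)| ≤ K →
        |(B.card : ℝ) - (n : ℝ)| ≤ K →
        |(C.card : ℝ) - (n : ℝ)| ≤ K →
        (({p : G × G | p.1 ∈ A ∧ p.2 ∈ B ∧ p.1 + p.2 ∉ C}).ncard : ℝ) ≤ K * (n : ℝ) →
        ∃ (H : AddSubgroup G) (x y : G), (H : Set G).Finite ∧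
          ((symmDiff (A : Set G) ((· + x) '' (H : Set G))).ncard : ℝ) ≤ c * K ∧
          ((symmDiff (B : Set G) ((· + y) '' (H : Set G))).ncard : ℝ) ≤ c * K ∧
          ((symmDiff (C : Set G) ((· + (x + y)) '' (H : Set G))).ncard : ℝ) ≤ c * K := by
  classical
  refine ⟨50, fun K hK => ⟨⌈1000 * K⌉₊, fun G _ n hn A B C hA hB hC hE => ?_⟩⟩
  have hn : 1000 * K ≤ n := Nat.ceil_le.1 hn
  have hset : {p : G × G | p.1 ∈ A ∧ p.2 ∈ B ∧ p.1 + p.2 ∉ C} =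
      (({p ∈ A ×ˢ B | p.1 + p.2 ∉ C} : Finset (G × G)) : Set (G × G)) := by
    ext p
    simp [and_assoc]
  rw [hset, Set.ncard_coe_finset] at hE
  obtain ⟨H, D, x, y, hH, h₁, h₂, h₃⟩ := exists_cosets_of_almost_closed hK hn hA hB hC hE
  refine ⟨H, x, y, ?_⟩
  rw [hH, ncard_symmDiff_translate, ncard_symmDiff_translate, ncard_symmDiff_translate]
  exact ⟨D.finite_toSet, h₁, h₂, h₃⟩
end

section
/- There is an absolute constant c such that the following holds: for every K > 0 there exists N such that for every abelian group G, every integer n ≥ N, and all finite subsets A, B, C, D of G whose cardinalities each differ from n by at most K, if there are at most Kn² triples (a,b,c) ∈ A × B × C with a + b + c ∉ D, then there exist a finite subgroup H of G and elements x, y, z ∈ G such that |A △ (H + x)| ≤ cK, |B △ (H + y)| ≤ cK, |C △ (H + z)| ≤ cK, and |D △ (H + x + y + z)| ≤ cK. -/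
open Finset in
/-- Double counting: if every fibre of `f` over `T` has at least `m` points of `P`, then
`|T| m ≤ |P|`. -/
theorem card_mul_le_card_of_le_fiber {α β : Type*} [DecidableEq β] (P : Finset α) (T : Finset β)
    (f : α → β) (m : ℝ) (h : ∀ t ∈ T, m ≤ (#{p ∈ P | f p = t} : ℝ)) :
    (#T : ℝ) * m ≤ #P := by
  have h1 : ∑ t ∈ T, #{p ∈ P | f p = t} ≤ #P := by
    rw [Finset.sum_card_fiberwise_eq_card_filter]
    exact card_filter_le _ _
  calc (#T : ℝ) * m = ∑ _t ∈ T, m := by simp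
    _ ≤ ∑ t ∈ T, (#{p ∈ P | f p = t} : ℝ) := sum_le_sum h
    _ ≤ #P := by exact_mod_cast h1

section

variable {G : Type*} [AddCommGroup G] [DecidableEq G]

open Finset

/-- The number of elements of `D` that translation by `x` moves out of `D`. -/
def translationDefect (D : Finset G) (x : G) : ℕ := #{d ∈ D | x + d ∉ D}

/-- The pairs of `A × B` whose sum does not lie in `D`. -/
def badPairs (A B D : Finset G) : Finset (G × G) := {p ∈ A ×ˢ B | p.1 + p.2 ∉ D}

theorem translationDefect_zero (D : Finset G) : translationDefect D 0 = 0 := by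
  simp [translationDefect, filter_eq_empty_iff]

theorem card_filter_add_mem (D : Finset G) (x : G) :
    #{d ∈ D | x + d ∈ D} + translationDefect D x = #D :=
  card_filter_add_card_filter_not (s := D) (fun d => x + d ∈ D)

theorem translationDefect_neg (D : Finset G) (x : G) :
    translationDefect D (-x) = translationDefect D x := by
  have h : #{d ∈ D | x + d ∈ D} = #{d ∈ D | -x + d ∈ D} := by
    apply card_nbij' (fun d => x + d) (fun d => -x + d) <;>
      simp +contextual [Set.MapsTo, Set.LeftInvOn, Set.RightInvOn]
  have h1 := card_filter_add_mem D x
  have h2 := card_filter_add_mem D (-x)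
  omega

theorem translationDefect_add_le (D : Finset G) (x y : G) :
    translationDefect D (x + y) ≤ translationDefect D x + translationDefect D y := by
  have h : {d ∈ D | x + y + d ∉ D} ⊆
      ({d ∈ D | x + d ∉ D}.image (fun d => -y + d)) ∪ {d ∈ D | y + d ∉ D} := by
    intro d hd
    simp only [mem_filter, mem_union, mem_image] at hd ⊢
    by_cases h : y + d ∈ D
    · refine Or.inl ⟨y + d, ⟨h, ?_⟩, by abel⟩
      rw [← add_assoc]
      exact hd.2
    · exact Or.inr ⟨hd.1, h⟩
  calc translationDefect D (x + y) ≤ _ := card_le_card h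
    _ ≤ _ := card_union_le _ _
    _ ≤ _ := Nat.add_le_add_right card_image_le _

/-- Elements of small defect are few. -/
theorem card_mul_le_of_translationDefect_le (D S : Finset G) (t : ℝ)
    (hS : ∀ x ∈ S, (translationDefect D x : ℝ) ≤ t) :
    (#S : ℝ) * (#D - t) ≤ (#D : ℝ) ^ 2 := by
  have h := card_mul_le_card_of_le_fiber (D ×ˢ D) S (fun p => p.2 - p.1) (#D - t) (by
    intro x hx
    have h1 : #{d ∈ D | x + d ∈ D} ≤ #{p ∈ D ×ˢ D | p.2 - p.1 = x} := by
      apply card_le_card_of_injOn (fun d => (d, x + d))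
      · intro d hd
        simpa using hd
      · intro a _ b _ hab
        exact (Prod.ext_iff.1 hab).1
    have h2 : (#{d ∈ D | x + d ∈ D} : ℝ) + translationDefect D x = #D := by
      exact_mod_cast card_filter_add_mem D x
    have h3 : (#{d ∈ D | x + d ∈ D} : ℝ) ≤ #{p ∈ D ×ˢ D | p.2 - p.1 = x} := by
      exact_mod_cast h1
    linarith [hS x hx])
  rw [card_product, Nat.cast_mul] at h
  linarith [sq (#D : ℝ)]

/-- If translating `B` by either of `a`, `a'` mostly lands in `D`, then `a - a'` has small
defect. -/
theorem translationDefect_sub_add_card_le (B D : Finset G) (a a' : G) :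
    translationDefect D (a - a') + #B ≤
      #D + #{b ∈ B | a + b ∉ D} + #{b ∈ B | a' + b ∉ D} := by
  have h : {d ∈ D | a - a' + d ∉ D} ⊆
      ({b ∈ B | a + b ∉ D}.image (fun b => a' + b)) ∪
        (D \ ({b ∈ B | a' + b ∈ D}.image (fun b => a' + b))) := by
    intro d hd
    simp only [mem_filter, mem_union, mem_image, mem_sdiff] at hd ⊢
    by_cases hb : d - a' ∈ B
    · refine Or.inl ⟨d - a', ⟨hb, ?_⟩, by abel⟩
      convert hd.2 using 2
      abel
    · refine Or.inr ⟨hd.1, ?_⟩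
      rintro ⟨b, ⟨hb1, -⟩, rfl⟩
      exact hb (by simpa using hb1)
  have hsub : {b ∈ B | a' + b ∈ D}.image (fun b => a' + b) ⊆ D := by
    intro d hd
    simp only [mem_filter, mem_image] at hd
    obtain ⟨b, hb, rfl⟩ := hd
    exact hb.2
  have h1 := card_sdiff_add_card_eq_card hsub
  rw [card_image_of_injective _ (add_right_injective a')] at h1
  have h2 := card_filter_add_card_filter_not (s := B) (fun b => a' + b ∈ D)
  have h3 := (card_le_card h).trans (card_union_le _ _)
  have h4 : #({b ∈ B | a + b ∉ D}.image (fun b => a' + b)) ≤ _ := card_image_le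
  unfold translationDefect
  omega

/-- The Markov inequality for rows of the set of bad pairs. -/
theorem card_bad_rows_mul_le (A B D : Finset G) (m : ℝ) :
    (#{a ∈ A | m < (#{b ∈ B | a + b ∉ D} : ℝ)} : ℝ) * m ≤ #(badPairs A B D) := by
  apply card_mul_le_card_of_le_fiber _ _ Prod.fst
  intro a ha
  simp only [mem_filter] at ha
  refine ha.2.le.trans ?_
  have : #{b ∈ B | a + b ∉ D} ≤ #{p ∈ badPairs A B D | p.1 = a} := by
    apply card_le_card_of_injOn (fun b => (a, b))
    · intro b hb
      simpa [badPairs, ha.1] using hb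
    · intro b _ b' _ hbb
      exact (Prod.ext_iff.1 hbb).2
  exact_mod_cast this

theorem card_badPairs_swap (A B D : Finset G) : #(badPairs B A D) = #(badPairs A B D) := by
  apply card_nbij' Prod.swap Prod.swap <;>
    simp +contextual [badPairs, Set.MapsTo, Set.LeftInvOn, Set.RightInvOn, add_comm]

/-- The rows `a` of `A` for which translation by `a` sends all but `n / 100` of `B` into `D`. -/
noncomputable def goodRows (A B D : Finset G) (n : ℝ) : Finset G :=
  {a ∈ A | (#{b ∈ B | a + b ∉ D} : ℝ) ≤ n / 100}

theorem card_sub_le_card_goodRows (A B D : Finset G) (n K : ℝ) (hn : 0 < n)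
    (h : (#(badPairs A B D) : ℝ) ≤ K * n) :
    (#A : ℝ) - 100 * K ≤ #(goodRows A B D n) := by
  have h1 := card_bad_rows_mul_le A B D (n / 100)
  have h2 := card_filter_add_card_filter_not (s := A)
    (fun a => (#{b ∈ B | a + b ∉ D} : ℝ) ≤ n / 100)
  simp only [not_le] at h2
  have h3 : (#(goodRows A B D n) : ℝ) +
      #{a ∈ A | n / 100 < (#{b ∈ B | a + b ∉ D} : ℝ)} = #A := by
    exact_mod_cast h2
  have h4 : (#{a ∈ A | n / 100 < (#{b ∈ B | a + b ∉ D} : ℝ)} : ℝ) ≤ 100 * K := by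
    refine le_of_mul_le_mul_right ?_ (by positivity : 0 < n / 100)
    linarith
  linarith

theorem translationDefect_sub_le_of_goodRows (A B D : Finset G) (n K : ℝ) (hKn : 1000 * K ≤ n)
    (hB : n - K ≤ #B) (hD : (#D : ℝ) ≤ n + K) (a a' : G)
    (ha : a ∈ goodRows A B D n) (ha' : a' ∈ goodRows A B D n) (hn : 0 < n) :
    (translationDefect D (a - a') : ℝ) ≤ 3 * n / 100 := by
  have h : (translationDefect D (a - a') : ℝ) + #B ≤
      #D + #{b ∈ B | a + b ∉ D} + #{b ∈ B | a' + b ∉ D} := by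
    exact_mod_cast translationDefect_sub_add_card_le B D a a'
  have h1 := (mem_filter.1 ha).2
  have h2 := (mem_filter.1 ha').2
  linarith

/-- The set of translations of small defect is a finite subgroup once it contains the differences
of a set of size almost `n`. -/
theorem exists_addSubgroup_of_translationDefect (D E : Finset G) (n : ℝ) (hn : 0 < n)
    (hD1 : 999 / 1000 * n ≤ #D) (hD2 : (#D : ℝ) ≤ 1001 / 1000 * n)
    (hE : 8 / 10 * n ≤ #E)
    (hsub : ∀ a ∈ E, ∀ a' ∈ E, (translationDefect D (a - a') : ℝ) ≤ 3 * n / 100) :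
    ∃ (H : AddSubgroup G) (S : Finset G), (∀ x, x ∈ S ↔ x ∈ H) ∧
      (∀ x, x ∈ H ↔ (translationDefect D x : ℝ) ≤ 3 * n / 100) ∧
      (#S : ℝ) ≤ 11 / 10 * n := by
  have hclosed : ∀ x, (translationDefect D x : ℝ) ≤ 6 * n / 100 →
      (translationDefect D x : ℝ) ≤ 3 * n / 100 := by
    intro x hx
    by_contra hcon
    have hEne : E.Nonempty := by
      rw [← card_pos]
      have : (0 : ℝ) < #E := by linarith
      exact_mod_cast this
    obtain ⟨a₀, ha₀⟩ := hEne
    have hdisj : Disjoint (E.image (fun a => a - a₀)) (E.image (fun a => x + (a - a₀))) := by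
      rw [disjoint_left]
      intro z hz hz'
      simp only [mem_image] at hz hz'
      obtain ⟨a, ha, rfl⟩ := hz
      obtain ⟨a', ha', h⟩ := hz'
      apply hcon
      have : x = a - a' := by
        rw [eq_sub_of_add_eq h]
        abel
      rw [this]
      exact hsub a ha a' ha'
    have hcard := card_union_of_disjoint hdisj
    rw [card_image_of_injective _ (sub_left_injective (b := a₀)), card_image_of_injective E
      (f := fun a => x + (a - a₀)) ((add_right_injective x).comp sub_left_injective)] at hcard
    have hle := card_mul_le_of_translationDefect_le D
      (E.image (fun a => a - a₀) ∪ E.image (fun a => x + (a - a₀))) (9 * n / 100) (by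
        intro z hz
        simp only [mem_union, mem_image] at hz
        rcases hz with ⟨a, ha, rfl⟩ | ⟨a, ha, rfl⟩
        · linarith [hsub a ha a₀ ha₀]
        · have : (translationDefect D (x + (a - a₀)) : ℝ) ≤
              translationDefect D x + translationDefect D (a - a₀) := by
            exact_mod_cast translationDefect_add_le D x (a - a₀)
          linarith [hsub a ha a₀ ha₀])
    rw [hcard] at hle
    push_cast at hle
    nlinarith
  let H : AddSubgroup G :=
    { carrier := {x | (translationDefect D x : ℝ) ≤ 3 * n / 100}
      zero_mem' := by
        simp only [Set.mem_ofPred_eq, translationDefect_zero, Nat.cast_zero]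
        positivity
      add_mem' := by
        intro x y hx hy
        simp only [Set.mem_ofPred_eq] at hx hy ⊢
        apply hclosed
        have : (translationDefect D (x + y) : ℝ) ≤
            translationDefect D x + translationDefect D y := by
          exact_mod_cast translationDefect_add_le D x y
        linarith
      neg_mem' := by
        intro x hx
        simpa only [Set.mem_ofPred_eq, translationDefect_neg] using hx }
  have hmem : ∀ x, x ∈ H ↔ (translationDefect D x : ℝ) ≤ 3 * n / 100 := fun x => Iff.rfl
  let S : Finset G :=
    {x ∈ (D ×ˢ D).image (fun p => p.2 - p.1) | (translationDefect D x : ℝ) ≤ 3 * n / 100}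
  refine ⟨H, S, fun x => ?_, hmem, ?_⟩
  · rw [hmem]
    refine ⟨fun hx => (mem_filter.1 hx).2, fun hx => mem_filter.2 ⟨?_, hx⟩⟩
    have h1 : (#{d ∈ D | x + d ∈ D} : ℝ) + translationDefect D x = #D := by
      exact_mod_cast card_filter_add_mem D x
    have h2 : (0 : ℝ) < #{d ∈ D | x + d ∈ D} := by linarith
    obtain ⟨d, hd⟩ := card_pos.1 (Nat.cast_pos.1 h2)
    rw [mem_filter] at hd
    exact mem_image.2 ⟨(d, x + d), mem_product.2 hd, by simp⟩
  · have h := card_mul_le_of_translationDefect_le D S (3 * n / 100)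
      (fun x hx => (mem_filter.1 hx).2)
    by_contra! hcon
    nlinarith

/-- If all but `K n` pairs of `A × B` have their sum in `D`, then `A`, `B` and `D` are close to
cosets of a finite subgroup. -/
theorem exists_addSubgroup_of_badPairs (A B D : Finset G) (n K : ℝ) (hK : 0 < K)
    (hKn : 1000 * K ≤ n)
    (hA : |(#A : ℝ) - n| ≤ K) (hB : |(#B : ℝ) - n| ≤ K) (hD : |(#D : ℝ) - n| ≤ K)
    (h : (#(badPairs A B D) : ℝ) ≤ K * n) :
    ∃ (H : AddSubgroup G) (S : Finset G) (x y : G), (∀ g, g ∈ S ↔ g ∈ H) ∧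
      (#(A \ S.image (· + x)) : ℝ) ≤ 100 * K ∧
      (#(B \ S.image (· + y)) : ℝ) ≤ 100 * K ∧
      (#(S.image (· + (x + y)) \ D) : ℝ) ≤ 2 * K := by
  rw [abs_le] at hA hB hD
  have hn : 0 < n := by linarith
  have hA' := card_sub_le_card_goodRows A B D n K hn h
  have hB' := card_sub_le_card_goodRows B A D n K hn (by rwa [card_badPairs_swap])
  have hAsub := translationDefect_sub_le_of_goodRows A B D n K hKn (by linarith) (by linarith)
  have hBsub := translationDefect_sub_le_of_goodRows B A D n K hKn (by linarith) (by linarith)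
  have hA'A : goodRows A B D n ⊆ A := filter_subset _ _
  have hB'B : goodRows B A D n ⊆ B := filter_subset _ _
  generalize goodRows A B D n = A' at *
  generalize goodRows B A D n = B' at *
  obtain ⟨H, S, hS, hH, hScard⟩ := exists_addSubgroup_of_translationDefect D A' n hn
    (by linarith) (by linarith) (by linarith) (fun a ha a' ha' => hAsub a a' ha ha' hn)
  obtain ⟨x, hx⟩ : A'.Nonempty := by
    rw [← card_pos, ← Nat.cast_pos (α := ℝ)]
    linarith
  obtain ⟨y, hy⟩ : B'.Nonempty := by
    rw [← card_pos, ← Nat.cast_pos (α := ℝ)]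
    linarith
  have hAx : ∀ a ∈ A', a - x ∈ S := fun a ha => (hS _).2 ((hH _).2 (hAsub a x ha hx hn))
  have hBy : ∀ b ∈ B', b - y ∈ S := fun b hb => (hS _).2 ((hH _).2 (hBsub b y hb hy hn))
  refine ⟨H, S, x, y, hS, ?_, ?_, ?_⟩
  · have h1 : A \ S.image (· + x) ⊆ A \ A' :=
      sdiff_subset_sdiff le_rfl fun a ha => mem_image.2 ⟨a - x, hAx a ha, by simp⟩
    have h2 : (#(A \ S.image (· + x)) : ℝ) ≤ #(A \ A') := by exact_mod_cast card_le_card h1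
    have h3 : (#(A \ A') : ℝ) + #A' = #A := by exact_mod_cast card_sdiff_add_card_eq_card hA'A
    linarith
  · have h1 : B \ S.image (· + y) ⊆ B \ B' :=
      sdiff_subset_sdiff le_rfl fun b hb => mem_image.2 ⟨b - y, hBy b hb, by simp⟩
    have h2 : (#(B \ S.image (· + y)) : ℝ) ≤ #(B \ B') := by exact_mod_cast card_le_card h1
    have h3 : (#(B \ B') : ℝ) + #B' = #B := by exact_mod_cast card_sdiff_add_card_eq_card hB'B
    linarith
  · have hcount := card_mul_le_card_of_le_fiber (badPairs A B D) (S.image (· + (x + y)) \ D)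
      (fun p => p.1 + p.2) (n / 2) (by
        intro g hg
        simp only [mem_sdiff, mem_image] at hg
        obtain ⟨⟨s, hs, rfl⟩, hgD⟩ := hg
        have h1 : A'.image (fun a => a - x) ∪ B'.image (fun b => s + (y - b)) ⊆ S := by
          apply union_subset
          · intro z hz
            obtain ⟨a, ha, rfl⟩ := mem_image.1 hz
            exact hAx a ha
          · intro z hz
            obtain ⟨b, hb, rfl⟩ := mem_image.1 hz
            rw [hS] at hs ⊢
            have := H.neg_mem ((hS _).1 (hBy b hb))
            rw [neg_sub] at this
            exact H.add_mem hs this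
        have h2 := card_union_add_card_inter (A'.image (fun a => a - x))
          (B'.image (fun b => s + (y - b)))
        rw [card_image_of_injective _ (sub_left_injective (b := x)), card_image_of_injective B'
          (f := fun b => s + (y - b)) ((add_right_injective s).comp sub_right_injective)] at h2
        have h3 := card_le_card h1
        have h4 : #(A'.image (fun a => a - x) ∩ B'.image (fun b => s + (y - b))) ≤
            #{p ∈ badPairs A B D | p.1 + p.2 = s + (x + y)} := by
          apply card_le_card_of_injOn (fun z => (z + x, s + y - z))
          · intro z hz
            simp only [coe_inter, coe_image, Set.mem_inter_iff, Set.mem_image, mem_coe] at hz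
            obtain ⟨⟨a, ha, rfl⟩, b, hb, hab⟩ := hz
            have hb' : s + y - (a - x) = b := by
              rw [← hab]
              abel
            have hsum : a + b = s + (x + y) := by
              rw [← hb']
              abel
            simp only [sub_add_cancel, hb', badPairs, coe_filter, mem_filter, mem_product,
              Set.mem_ofPred_eq, hsum]
            exact ⟨⟨⟨hA'A ha, hB'B hb⟩, hgD⟩, trivial⟩
          · intro z _ z' _ hzz
            exact add_right_cancel (Prod.ext_iff.1 hzz).1
        have h5 : (#A' : ℝ) + #B' ≤
            #S + #{p ∈ badPairs A B D | p.1 + p.2 = s + (x + y)} := by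
          exact_mod_cast (by omega)
        linarith)
    refine le_of_mul_le_mul_right ?_ (by positivity : 0 < n / 2)
    linarith

theorem ncard_symmDiff_image_add (A S : Finset G) (H : AddSubgroup G) (x : G)
    (hS : ∀ g, g ∈ S ↔ g ∈ H) :
    (symmDiff (A : Set G) ((· + x) '' (H : Set G))).ncard =
      #(A \ S.image (· + x)) + #(S.image (· + x) \ A) := by
  have hH : (H : Set G) = S := Set.ext fun g => (hS g).symm
  rw [hH, ← coe_image, ← coe_symmDiff, Set.ncard_coe_finset]
  exact card_union_of_disjoint disjoint_sdiff_sdiff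

theorem card_sdiff_image_add (A S : Finset G) (x : G) :
    (#(A \ S.image (· + x)) : ℝ) + #S = #(S.image (· + x) \ A) + #A := by
  have h1 := card_sdiff_add_card_inter A (S.image (· + x))
  have h2 := card_sdiff_add_card_inter (S.image (· + x)) A
  rw [card_image_of_injective _ (add_left_injective x)] at h2
  rw [inter_comm] at h2
  exact_mod_cast (by omega)

/-- If `A` and `B` fill most of cosets of a subgroup `H` and `g` is not in the coset `H + z`,
then most pairs of `A × B` have their sum outside `D - g`, provided `D` has few elements outside
`H + x + y + z`. -/
theorem mul_le_card_badPairs (A B D E S : Finset G) (H : AddSubgroup G) (hS : ∀ g, g ∈ S ↔ g ∈ H)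
    (x y z g : G) (hg : g ∉ S.image (· + z))
    (hE : E = {u ∈ D | u ∉ S.image (· + (x + y + z))}) :
    (#(A ∩ S.image (· + x)) : ℝ) * ((#(B ∩ S.image (· + y)) : ℝ) - #E) ≤
      #{p ∈ A ×ˢ B | p.1 + p.2 + g ∉ D} := by
  apply card_mul_le_card_of_le_fiber _ _ Prod.fst
  intro a ha
  rw [mem_inter] at ha
  have h1 : #(B ∩ S.image (· + y)) ≤ #{b ∈ B | a + b + g ∉ D} + #E := by
    have hsub : B ∩ S.image (· + y) ⊆
        {b ∈ B | a + b + g ∉ D} ∪ E.image (fun u => u - (a + g)) := by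
      intro b hb
      rw [mem_inter] at hb
      rw [mem_union, mem_filter]
      by_cases h : a + b + g ∈ D
      · refine Or.inr (mem_image.2 ⟨a + b + g, ?_, by abel⟩)
        rw [hE, mem_filter]
        refine ⟨h, fun hmem => hg ?_⟩
        obtain ⟨s, hs, hsx⟩ := mem_image.1 ha.2
        obtain ⟨t, ht, hty⟩ := mem_image.1 hb.2
        obtain ⟨u, hu, huz⟩ := mem_image.1 hmem
        rw [hS] at hs ht hu
        refine mem_image.2 ⟨u - s - t, (hS _).2 (H.sub_mem (H.sub_mem hu hs) ht), ?_⟩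
        have : g = u + (x + y + z) - a - b := by
          rw [huz]
          abel
        rw [this, ← hsx, ← hty]
        abel
      · exact Or.inl ⟨hb.1, h⟩
    exact (card_le_card hsub).trans ((card_union_le _ _).trans
      (Nat.add_le_add_left card_image_le _))
  have h2 : #{b ∈ B | a + b + g ∉ D} ≤
      #{p ∈ {p ∈ A ×ˢ B | p.1 + p.2 + g ∉ D} | p.1 = a} := by
    apply card_le_card_of_injOn (fun b => (a, b))
    · intro b hb
      simpa [ha.1] using hb
    · intro b _ b' _ hbb
      exact (Prod.ext_iff.1 hbb).2
  have h3 : (#(B ∩ S.image (· + y)) : ℝ) ≤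
      #{p ∈ {p ∈ A ×ˢ B | p.1 + p.2 + g ∉ D} | p.1 = a} + #E := by
    exact_mod_cast h1.trans (Nat.add_le_add_right h2 _)
  linarith

/-- If every `c ∈ E` gives at least `m` bad pairs, there are at least `|E| m` bad triples. -/
theorem card_mul_le_ncard_bad_triples (A B C D E : Finset G) (hE : E ⊆ C) (m : ℝ)
    (h : ∀ c ∈ E, m ≤ (#{p ∈ A ×ˢ B | p.1 + p.2 + c ∉ D} : ℝ)) :
    (#E : ℝ) * m ≤ ({t : G × G × G | t.1 ∈ A ∧ t.2.1 ∈ B ∧ t.2.2 ∈ C ∧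
      t.1 + t.2.1 + t.2.2 ∉ D}).ncard := by
  have hset : {t : G × G × G | t.1 ∈ A ∧ t.2.1 ∈ B ∧ t.2.2 ∈ C ∧ t.1 + t.2.1 + t.2.2 ∉ D} =
      ({t ∈ A ×ˢ B ×ˢ C | t.1 + t.2.1 + t.2.2 ∉ D} : Finset (G × G × G)) := by
    ext t
    simp [and_assoc]
  rw [hset, Set.ncard_coe_finset]
  apply card_mul_le_card_of_le_fiber _ _ (fun t => t.2.2)
  intro c hc
  refine (h c hc).trans ?_
  have : #{p ∈ A ×ˢ B | p.1 + p.2 + c ∉ D} ≤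
      #{t ∈ {t ∈ A ×ˢ B ×ˢ C | t.1 + t.2.1 + t.2.2 ∉ D} | t.2.2 = c} := by
    apply card_le_card_of_injOn (fun p => (p.1, p.2, c))
    · intro p hp
      simpa [hE hc] using hp
    · intro p _ p' _ hpp
      have h1 := (Prod.ext_iff.1 hpp)
      exact Prod.ext h1.1 (Prod.ext_iff.1 h1.2).1
  exact_mod_cast this

end

/-- Four finite subsets of an abelian group, each of size roughly `n`, such that for all
but at most `Kn²` triples `(a,b,c) ∈ A × B × C` one has `a + b + c ∈ D`, are close to
cosets of a common finite subgroup. -/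
theorem almost_group_four_sets :
    ∃ c : ℝ, ∀ K : ℝ, 0 < K → ∃ N : ℕ,
      ∀ (G : Type) (_ : AddCommGroup G), ∀ n : ℕ, N ≤ n →
      ∀ A B C D : Finset G,
        |(A.card : ℝ) - (n : ℝ)| ≤ K →
        |(B.card : ℝ) - (n : ℝ)| ≤ K →
        |(C.card : ℝ) - (n : ℝ)| ≤ K →
        |(D.card : ℝ) - (n : ℝ)| ≤ K →
        (({t : G × G × G | t.1 ∈ A ∧ t.2.1 ∈ B ∧ t.2.2 ∈ C ∧
            t.1 + t.2.1 + t.2.2 ∉ D}).ncard : ℝ) ≤ K * (n : ℝ) ^ 2 →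
        ∃ (H : AddSubgroup G) (x y z : G), (H : Set G).Finite ∧
          ((symmDiff (A : Set G) ((· + x) '' (H : Set G))).ncard : ℝ) ≤ c * K ∧
          ((symmDiff (B : Set G) ((· + y) '' (H : Set G))).ncard : ℝ) ≤ c * K ∧
          ((symmDiff (C : Set G) ((· + z) '' (H : Set G))).ncard : ℝ) ≤ c * K ∧
          ((symmDiff (D : Set G) ((· + (x + y + z)) '' (H : Set G))).ncard : ℝ) ≤ c * K := by
  classical
  refine ⟨500, fun K hK => ⟨⌈2000 * K⌉₊, fun G _ n hn A B C D hA hB hC hD hT => ?_⟩⟩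
  have hKn : 2000 * K ≤ n := Nat.ceil_le.1 hn
  have hn0 : (0 : ℝ) < n := by linarith
  obtain ⟨z, hz, hzbad⟩ :
      ∃ z ∈ C, ((A ×ˢ B).filter (fun p => p.1 + p.2 + z ∉ D)).card ≤ 2 * K * (n : ℝ) := by
    by_contra! hcon
    have h := (card_mul_le_ncard_bad_triples A B C D C subset_rfl (2 * K * n)
      fun c hc => (hcon c hc).le).trans hT
    rw [abs_le] at hC
    nlinarith [mul_pos hK hn0]
  have hDcard : (D.image (· - z)).card = D.card :=
    Finset.card_image_of_injective _ sub_left_injective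
  have hmem (g : G) : g ∈ D.image (· - z) ↔ g + z ∈ D := by
    simp [sub_eq_iff_eq_add]
  obtain ⟨H, S, x, y, hS, hAS, hBS, hSD⟩ := exists_addSubgroup_of_badPairs A B (D.image (· - z))
    n (2 * K) (by linarith) (by linarith) (hA.trans (by linarith)) (hB.trans (by linarith))
    (by rw [hDcard]; exact hD.trans (by linarith)) (by simpa only [badPairs, hmem] using hzbad)
  have hSD' : (S.image (· + (x + y + z)) \ D).card ≤
      (S.image (· + (x + y)) \ D.image (· - z)).card := by
    apply Finset.card_le_card_of_injOn (· - z)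
    · intro g hg
      simp only [Finset.coe_sdiff, Set.mem_sdiff, Finset.mem_coe, Finset.mem_image] at hg ⊢
      obtain ⟨⟨s, hs, rfl⟩, hg⟩ := hg
      refine ⟨⟨s, hs, by abel⟩, ?_⟩
      rintro ⟨d, hd, hdz⟩
      exact hg (sub_left_injective hdz ▸ hd)
    · exact sub_left_injective.injOn
  have hSD'' : ((S.image (· + (x + y + z)) \ D).card : ℝ) ≤ 2 * (2 * K) :=
    le_trans (by exact_mod_cast hSD') hSD
  rw [abs_le] at hA hB hC hD
  have eA := card_sdiff_image_add A S x
  have eB := card_sdiff_image_add B S y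
  have eC := card_sdiff_image_add C S z
  have eD := card_sdiff_image_add D S (x + y + z)
  have iA : ((A \ S.image (· + x)).card : ℝ) + (A ∩ S.image (· + x)).card = A.card := by
    exact_mod_cast Finset.card_sdiff_add_card_inter _ _
  have iB : ((B \ S.image (· + y)).card : ℝ) + (B ∩ S.image (· + y)).card = B.card := by
    exact_mod_cast Finset.card_sdiff_add_card_inter _ _
  have pA : (0 : ℝ) ≤ (S.image (· + x) \ A).card := Nat.cast_nonneg _
  have pD : (0 : ℝ) ≤ (D \ S.image (· + (x + y + z))).card := Nat.cast_nonneg _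
  have hCS : ((C \ S.image (· + z)).card : ℝ) ≤ 2 * K := by
    have h := (card_mul_le_ncard_bad_triples A B C D (C \ S.image (· + z)) Finset.sdiff_subset
      (n ^ 2 / 2) (fun g hg => by
        refine le_trans ?_ (mul_le_card_badPairs A B D _ S H hS x y z g
          (Finset.mem_sdiff.1 hg).2 (Finset.sdiff_eq_filter _ _))
        have h1 : 3 / 4 * (n : ℝ) ≤ (A ∩ S.image (· + x)).card := by linarith
        have h2 : 3 / 4 * (n : ℝ) ≤ (B ∩ S.image (· + y)).card -
          (D \ S.image (· + (x + y + z))).card := by linarith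
        calc (n : ℝ) ^ 2 / 2 ≤ 3 / 4 * n * (3 / 4 * n) := by nlinarith only [sq_nonneg (n : ℝ)]
          _ ≤ _ := mul_le_mul h1 h2 (by positivity) (by positivity))).trans hT
    refine le_of_mul_le_mul_right ?_ (by positivity : (0 : ℝ) < n ^ 2 / 2)
    linarith
  refine ⟨H, x, y, z, ?_, ?_, ?_, ?_, ?_⟩
  · exact S.finite_toSet.subset fun g hg => (hS g).2 hg
  all_goals
    rw [ncard_symmDiff_image_add _ S H _ hS]
    push_cast
    linarith
end

section
/- There is an absolute constant C such that the following holds: if P is a set of n points in ℝ² and there exist two circles σ₁ and σ₂ with P ⊆ σ₁ ∪ σ₂, then the number of lines in ℝ² containing at least three points of P is at most C·n^{11/6}. -/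
noncomputable section

section

open Polynomial

/-- Vanishes iff `(u, v)` lies on the line through the points of the unit circle with
half-angle tangents `x` and `y`. -/
def chordForm {K : Type*} [CommRing K] (u v x y : K) : K :=
  u - 1 + v * (x + y) - (u + 1) * (x * y)

/-- Four times the homogenisation of `(u - a) ^ 2 + (v - b) ^ 2 - s ^ 2` in the coordinates
`(α, β, γ) = (-(u + 1), v, u - 1)`. -/
def conicForm {K : Type*} [CommRing K] (a b s α β γ : K) : K :=
  (γ - α + a * (α + γ)) ^ 2 + (2 * β + b * (α + γ)) ^ 2 - s ^ 2 * (α + γ) ^ 2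

/-- `conicForm` at the point `r'` such that projecting from `r` and then from `r'` takes
`x₁` to `x₁'` and `x₂` to `x₂'`, as a form in the coordinates `(α, β, γ)` of `r`. -/
def transferForm {K : Type*} [CommRing K] (a b s x₁ x₁' x₂ x₂' α β γ : K) : K :=
  conicForm a b s
    ((α * x₁ + β) * (β * x₂ + γ - (α * x₂ + β) * x₂')
      - (α * x₂ + β) * (β * x₁ + γ - (α * x₁ + β) * x₁'))
    ((α * x₂ + β) * (β * x₁ + γ) * x₁' - (α * x₁ + β) * (β * x₂ + γ) * x₂')
    ((β * x₁ + γ) * x₁' * (β * x₂ + γ - (α * x₂ + β) * x₂')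
      - (β * x₂ + γ) * x₂' * (β * x₁ + γ - (α * x₁ + β) * x₁'))

theorem transferForm_mul {K : Type*} [CommRing K] (a b s x₁ x₁' x₂ x₂' α β γ z : K) :
    transferForm a b s x₁ x₁' x₂ x₂' (z * α) (z * β) (z * γ) =
      z ^ 4 * transferForm a b s x₁ x₁' x₂ x₂' α β γ := by
  unfold transferForm conicForm
  ring

theorem transferForm_eq_zero {K : Type*} [Field K] [CharZero K]
    {a b s x₁ x₁' x₂ x₂' u v u' v' y₁ y₂ : K}
    (h₁ : chordForm u v x₁ y₁ = 0) (h₁' : chordForm u' v' x₁' y₁ = 0)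
    (h₂ : chordForm u v x₂ y₂ = 0) (h₂' : chordForm u' v' x₂' y₂ = 0)
    (hc : (u' - a) ^ 2 + (v' - b) ^ 2 = s ^ 2) :
    transferForm a b s x₁ x₁' x₂ x₂' (-(u + 1)) v (u - 1) = 0 := by
  unfold transferForm
  unfold chordForm at *
  have e₁ : v * x₁ + (u - 1) = -(-(u + 1) * x₁ + v) * y₁ := by linear_combination h₁
  have e₂ : v * x₂ + (u - 1) = -(-(u + 1) * x₂ + v) * y₂ := by linear_combination h₂
  rw [e₁, e₂]
  set d₁ := -(u + 1) * x₁ + v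
  set d₂ := -(u + 1) * x₂ + v
  -- the first argument of `conicForm` is proportional to the coordinates of `r'`
  generalize hw₁ : d₁ * (-d₂ * y₂ - d₂ * x₂') - d₂ * (-d₁ * y₁ - d₁ * x₁') = w₁
  generalize hw₂ : d₂ * (-d₁ * y₁) * x₁' - d₁ * (-d₂ * y₂) * x₂' = w₂
  generalize hw₃ : -d₁ * y₁ * x₁' * (-d₂ * y₂ - d₂ * x₂')
    - -d₂ * y₂ * x₂' * (-d₁ * y₁ - d₁ * x₁') = w₃
  have p₁₂ : -(u' + 1) * w₂ = v' * w₁ := by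
    rw [← hw₁, ← hw₂]; linear_combination d₁ * d₂ * h₂' - d₁ * d₂ * h₁'
  have p₂₃ : v' * w₃ = (u' - 1) * w₂ := by
    rw [← hw₃, ← hw₂]
    linear_combination d₁ * d₂ * (y₁ * x₁') * h₂' - d₁ * d₂ * (y₂ * x₂') * h₁'
  have p₁₃ : -(u' + 1) * w₃ = (u' - 1) * w₁ := by
    rw [← hw₁, ← hw₃]
    linear_combination d₁ * d₂ * (y₂ + x₂') * h₁' - d₁ * d₂ * (y₁ + x₁') * h₂'
  have q₁ : 2 * w₁ = (u' + 1) * (w₁ + w₃) := by linear_combination p₁₃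
  have q₂ : 2 * w₂ = -v' * (w₁ + w₃) := by linear_combination p₂₃ - p₁₂
  have q₃ : 2 * w₃ = -(u' - 1) * (w₁ + w₃) := by linear_combination -p₁₃
  have : 4 * conicForm a b s w₁ w₂ w₃ = 0 := by
    have : 4 * conicForm a b s w₁ w₂ w₃ = conicForm a b s (2 * w₁) (2 * w₂) (2 * w₃) := by
      unfold conicForm; ring
    rw [this, q₁, q₂, q₃]
    unfold conicForm
    linear_combination 4 * (w₁ + w₃) ^ 2 * hc
  simpa using this

theorem card_le_two_of_quadratic {K : Type*} [Field K] [DecidableEq K] {p q r : K} (S : Finset K)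
    (h : p ≠ 0 ∨ q ≠ 0 ∨ r ≠ 0) (hS : ∀ z ∈ S, p * z ^ 2 + q * z + r = 0) : S.card ≤ 2 := by
  have hne : C p * X ^ 2 + C q * X + C r ≠ 0 := by
    intro h0
    have h₂ := congrArg (fun f => coeff f 2) h0
    have h₁ := congrArg (fun f => coeff f 1) h0
    have h₀ := congrArg (fun f => coeff f 0) h0
    simp [coeff_X, coeff_C] at h₂ h₁ h₀
    tauto
  have hsub : S ⊆ (C p * X ^ 2 + C q * X + C r).roots.toFinset := by
    intro z hz
    rw [Multiset.mem_toFinset, mem_roots hne]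
    simpa [IsRoot] using hS z hz
  calc S.card ≤ _ := Finset.card_le_card hsub
    _ ≤ _ := Multiset.toFinset_card_le _
    _ ≤ _ := card_roots' _
    _ ≤ 2 := natDegree_quadratic_le

/-- The complexified line through `x` and `y`, in terms of the coordinate `z` on `σ₂`. -/
theorem mul_chordForm_param (a b s x y : ℂ) {z : ℂ} (hz : z ≠ 0) :
    z * chordForm (a + s * (z + z⁻¹) / 2) (b - Complex.I * s * (z - z⁻¹) / 2) x y =
      s / 2 * ((1 - Complex.I * x) * (1 - Complex.I * y)) * z ^ 2
        + (a * (1 - x * y) + b * (x + y) - (1 + x * y)) * z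
        + s / 2 * ((1 + Complex.I * x) * (1 + Complex.I * y)) := by
  unfold chordForm
  field_simp
  ring_nf
  simp only [Complex.I_sq]
  ring

theorem one_add_I_mul_ofReal_ne_zero (x : ℝ) : 1 + Complex.I * x ≠ 0 := by
  intro h
  simpa using congrArg Complex.re h

theorem one_sub_I_mul_ofReal_ne_zero (x : ℝ) : 1 - Complex.I * x ≠ 0 := by
  intro h
  simpa using congrArg Complex.re h

theorem param_mem_circle (a b s : ℂ) {z : ℂ} (hz : z ≠ 0) :
    (a + s * (z + z⁻¹) / 2 - a) ^ 2 + (b - Complex.I * s * (z - z⁻¹) / 2 - b) ^ 2 = s ^ 2 := by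
  field_simp
  ring_nf
  simp only [Complex.I_sq]
  ring

theorem transferForm_of_chordForm_eq_zero {K : Type*} [CommRing K] {a b s x₁ x₁' x₂ x₂' u v : K}
    (h : chordForm u v x₂ x₁' = 0) :
    transferForm a b s x₁ x₁' x₂ x₂' (-(u + 1)) v (u - 1) =
      ((-(u + 1) * x₂ + v) * chordForm u v x₁ x₂') ^ 2 * conicForm a b s 1 (-x₁') (x₁' ^ 2) := by
  have e : v * x₂ + (u - 1) = -(-(u + 1) * x₂ + v) * x₁' := by
    unfold chordForm at h; linear_combination h
  unfold transferForm
  rw [e]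
  unfold conicForm chordForm
  ring

theorem exists_quadratic_roots {p q r : ℂ} (hp : p ≠ 0) (hd : q ^ 2 - 4 * p * r ≠ 0) :
    ∃ z₁ z₂ : ℂ, z₁ ≠ z₂ ∧ p * z₁ ^ 2 + q * z₁ + r = 0 ∧ p * z₂ ^ 2 + q * z₂ + r = 0 := by
  obtain ⟨d, hd'⟩ := IsAlgClosed.exists_pow_nat_eq (q ^ 2 - 4 * p * r) (n := 2) (by norm_num)
  have hd0 : d ≠ 0 := by
    rintro rfl
    exact hd (by rw [← hd']; simp)
  refine ⟨(-q + d) / (2 * p), (-q - d) / (2 * p), ?_, ?_, ?_⟩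
  · intro h
    field_simp at h
    exact hd0 (by linear_combination h / 2)
  · field_simp
    linear_combination hd'
  · field_simp
    linear_combination hd'

theorem quadratic_proportional {K : Type*} [Field K] {p q r p' q' r' z₁ z₂ : K} (hz : z₁ ≠ z₂)
    (h₁ : p * z₁ ^ 2 + q * z₁ + r = 0) (h₂ : p * z₂ ^ 2 + q * z₂ + r = 0)
    (h₁' : p' * z₁ ^ 2 + q' * z₁ + r' = 0) (h₂' : p' * z₂ ^ 2 + q' * z₂ + r' = 0) :
    p * q' = p' * q ∧ p * r' = p' * r := by
  have hz' : z₁ - z₂ ≠ 0 := sub_ne_zero.2 hz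
  have hq : q = -p * (z₁ + z₂) := mul_left_cancel₀ hz' (by linear_combination h₁ - h₂)
  have hq' : q' = -p' * (z₁ + z₂) := mul_left_cancel₀ hz' (by linear_combination h₁' - h₂')
  subst hq hq'
  exact ⟨by ring, by linear_combination p * h₁' - p' * h₁⟩

theorem conicForm_eq_zero_of_center {K : Type*} [Field K] [CharZero K] {a b s u v x : K}
    (h : v = (u + 1) * x) (h' : u - 1 + v * x = 0) (hc : (u - a) ^ 2 + (v - b) ^ 2 = s ^ 2) :
    conicForm a b s 1 (-x) (x ^ 2) = 0 := by
  subst h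
  have e₁ : u * (1 + x ^ 2) = 1 - x ^ 2 := by linear_combination h'
  have e₂ : (u + 1) * x * (1 + x ^ 2) = 2 * x := by linear_combination x * e₁
  unfold conicForm
  linear_combination (1 + x ^ 2) ^ 2 * hc -
    (u * (1 + x ^ 2) + (1 - x ^ 2) - 2 * a * (1 + x ^ 2)) * e₁
    - ((u + 1) * x * (1 + x ^ 2) + 2 * x - 2 * b * (1 + x ^ 2)) * e₂

theorem exists_transferForm_ne_zero {a b s x₁ x₁' x₂ x₂' : ℝ} (hs : s ≠ 0)
    (h₁₂ : x₁ ≠ x₂) (h₁ : x₁ ≠ x₁')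
    (hx₁' : conicForm a b s 1 (-x₁') (x₁' ^ 2) ≠ 0) (hx₂ : conicForm a b s 1 (-x₂) (x₂ ^ 2) ≠ 0)
    (ht : (a * (1 - x₂ * x₁') + b * (x₂ + x₁') - (1 + x₂ * x₁')) ^ 2 ≠
      s ^ 2 * (1 + x₂ ^ 2) * (1 + x₁' ^ 2)) :
    ∃ z : ℂ, z ≠ 0 ∧ transferForm (a : ℂ) b s x₁ x₁' x₂ x₂' (-(a + s * (z + z⁻¹) / 2 + 1))
      (b - Complex.I * s * (z - z⁻¹) / 2) (a + s * (z + z⁻¹) / 2 - 1) ≠ 0 := by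
  have hsC : (s : ℂ) ≠ 0 := by exact_mod_cast hs
  have hI := Complex.I_sq
  have hx₁'C : conicForm (a : ℂ) b s 1 (-x₁') (x₁' ^ 2) ≠ 0 := by
    unfold conicForm at *; exact_mod_cast hx₁'
  have hx₂C : conicForm (a : ℂ) b s 1 (-x₂) (x₂ ^ 2) ≠ 0 := by
    unfold conicForm at *; exact_mod_cast hx₂
  have htC : ((a : ℂ) * (1 - x₂ * x₁') + b * (x₂ + x₁') - (1 + x₂ * x₁')) ^ 2 ≠
      s ^ 2 * (1 + x₂ ^ 2) * (1 + x₁' ^ 2) := by exact_mod_cast ht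
  have hr : (s : ℂ) / 2 * ((1 + Complex.I * x₂) * (1 + Complex.I * x₁')) ≠ 0 := by
    simp [hsC, one_add_I_mul_ofReal_ne_zero]
  have hp : (s : ℂ) / 2 * ((1 - Complex.I * x₂) * (1 - Complex.I * x₁')) ≠ 0 := by
    simp [hsC, one_sub_I_mul_ofReal_ne_zero]
  obtain ⟨z₁, z₂, hz, hz₁, hz₂⟩ := exists_quadratic_roots hp (r := (s : ℂ) / 2 *
    ((1 + Complex.I * x₂) * (1 + Complex.I * x₁')))
    (q := (a : ℂ) * (1 - x₂ * x₁') + b * (x₂ + x₁') - (1 + x₂ * x₁')) (by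
      intro h
      apply htC
      have e (x : ℂ) : (1 - Complex.I * x) * (1 + Complex.I * x) = 1 + x ^ 2 := by
        linear_combination -x ^ 2 * hI
      rw [← e, ← e]
      linear_combination h)
  by_contra! H
  have key : ∀ z : ℂ, (s : ℂ) / 2 * ((1 - Complex.I * x₂) * (1 - Complex.I * x₁')) * z ^ 2
        + (a * (1 - x₂ * x₁') + b * (x₂ + x₁') - (1 + x₂ * x₁')) * z
        + s / 2 * ((1 + Complex.I * x₂) * (1 + Complex.I * x₁')) = 0 →
      (s : ℂ) / 2 * ((1 - Complex.I * x₁) * (1 - Complex.I * x₂')) * z ^ 2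
        + (a * (1 - x₁ * x₂') + b * (x₁ + x₂') - (1 + x₁ * x₂')) * z
        + s / 2 * ((1 + Complex.I * x₁) * (1 + Complex.I * x₂')) = 0 := by
    intro z h
    have hz0 : z ≠ 0 := by
      rintro rfl
      exact hr (by linear_combination h)
    have hT := H z hz0
    have hc := param_mem_circle (a : ℂ) b s hz0
    rw [← mul_chordForm_param _ _ _ _ _ hz0] at h ⊢
    have h := (mul_eq_zero.1 h).resolve_left hz0
    generalize (a : ℂ) + s * (z + z⁻¹) / 2 = u at *
    generalize (b : ℂ) - Complex.I * s * (z - z⁻¹) / 2 = v at *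
    rw [transferForm_of_chordForm_eq_zero h] at hT
    have hT := (mul_eq_zero.1 hT).resolve_right hx₁'C
    rcases mul_eq_zero.1 (pow_eq_zero_iff two_ne_zero |>.1 hT) with h0 | h0
    · refine absurd (conicForm_eq_zero_of_center (x := (x₂ : ℂ)) ?_ ?_ hc) hx₂C
      · linear_combination h0
      · unfold chordForm at h; linear_combination h - x₁' * h0
    · rw [h0, mul_zero]
  obtain ⟨k₁, k₂⟩ := quadratic_proportional hz hz₁ hz₂ (key _ hz₁) (key _ hz₂)
  have hI0 := Complex.I_ne_zero
  -- comparing real and imaginary parts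
  have hs2 : (s : ℂ) ^ 2 * Complex.I ≠ 0 := mul_ne_zero (pow_ne_zero _ hsC) hI0
  have m₁ : ((1 - x₂ * x₁') * (x₁ + x₂') : ℂ) = (1 - x₁ * x₂') * (x₂ + x₁') := by
    apply mul_left_cancel₀ hs2
    linear_combination 2 * k₂ +
      s ^ 2 * Complex.I * (x₁ * x₂' * (x₂ + x₁') - x₂ * x₁' * (x₁ + x₂')) * hI
  have m₁' : ((1 - x₂ * x₁') * (x₁ + x₂')) = (1 - x₁ * x₂') * (x₂ + x₁') := by exact_mod_cast m₁
  have k₁' : ((1 - x₂ * x₁') - Complex.I * (x₂ + x₁')) *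
      ((a : ℂ) * (1 - x₁ * x₂') + b * (x₁ + x₂') - (1 + x₁ * x₂')) =
      ((1 - x₁ * x₂') - Complex.I * (x₁ + x₂')) *
      ((a : ℂ) * (1 - x₂ * x₁') + b * (x₂ + x₁') - (1 + x₂ * x₁')) := by
    apply mul_left_cancel₀ hsC
    linear_combination 2 * k₁ +
      (s * x₁ * x₂' * (a * (1 - x₂ * x₁') + b * (x₂ + x₁') - (1 + x₂ * x₁')) -
        s * x₂ * x₁' * ((a : ℂ) * (1 - x₁ * x₂') + b * (x₁ + x₂') - (1 + x₁ * x₂'))) * hI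
  have m₂ := congrArg Complex.re k₁'
  have m₃ := congrArg Complex.im k₁'
  simp [← Complex.ofReal_mul, ← Complex.ofReal_add] at m₂ m₃
  have hP : x₁ * x₂' = x₂ * x₁' := by linear_combination (-m₂ + b * m₁') / 2
  have hS : x₁ + x₂' = x₂ + x₁' := by
    rw [hP] at m₁' m₃
    by_contra hne
    have hne := sub_ne_zero.2 hne
    have e₁ : 1 - x₂ * x₁' = 0 := mul_left_cancel₀ hne (by linear_combination m₁')
    have e₂ : 1 + x₂ * x₁' = 0 := mul_left_cancel₀ hne (by linear_combination -m₃ + a * m₁')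
    linarith
  have : (x₁ - x₂) * (x₁ - x₁') = 0 := by linear_combination x₁ * hS - hP
  rcases mul_eq_zero.1 this with h | h
  · exact h₁₂ (sub_eq_zero.1 h)
  · exact h₁ (sub_eq_zero.1 h)

theorem natDegree_transferForm_le {K : Type*} [CommRing K] (a b s x₁ x₁' x₂ x₂' : K)
    {α β γ : K[X]} (hα : α.natDegree ≤ 2) (hβ : β.natDegree ≤ 2) (hγ : γ.natDegree ≤ 2) :
    (transferForm (C a) (C b) (C s) (C x₁) (C x₁') (C x₂) (C x₂') α β γ).natDegree ≤ 8 := by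
  unfold transferForm conicForm
  compute_degree
  omega

theorem card_le_of_transferForm_eq_zero {a b s x₁ x₁' x₂ x₂' : ℝ} (hs : s ≠ 0)
    (h₁₂ : x₁ ≠ x₂) (h₁ : x₁ ≠ x₁')
    (hx₁' : conicForm a b s 1 (-x₁') (x₁' ^ 2) ≠ 0) (hx₂ : conicForm a b s 1 (-x₂) (x₂ ^ 2) ≠ 0)
    (ht : (a * (1 - x₂ * x₁') + b * (x₂ + x₁') - (1 + x₂ * x₁')) ^ 2 ≠
      s ^ 2 * (1 + x₂ ^ 2) * (1 + x₁' ^ 2)) (Z : Finset ℂ) (hZ : ∀ z ∈ Z, z ≠ 0 ∧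
      transferForm (a : ℂ) b s x₁ x₁' x₂ x₂' (-(a + s * (z + z⁻¹) / 2 + 1))
        (b - Complex.I * s * (z - z⁻¹) / 2) (a + s * (z + z⁻¹) / 2 - 1) = 0) :
    Z.card ≤ 8 := by
  set F : ℂ[X] := transferForm (C (a : ℂ)) (C (b : ℂ)) (C (s : ℂ)) (C (x₁ : ℂ)) (C (x₁' : ℂ))
    (C (x₂ : ℂ)) (C (x₂' : ℂ)) (-(C (s / 2 : ℂ) * X ^ 2 + C (a + 1 : ℂ) * X + C (s / 2 : ℂ)))
    (C (-Complex.I * s / 2) * X ^ 2 + C (b : ℂ) * X + C (Complex.I * s / 2))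
    (C (s / 2 : ℂ) * X ^ 2 + C (a - 1 : ℂ) * X + C (s / 2 : ℂ)) with hF
  have hev (z : ℂ) (hz : z ≠ 0) : F.eval z = z ^ 4 *
      transferForm (a : ℂ) b s x₁ x₁' x₂ x₂' (-(a + s * (z + z⁻¹) / 2 + 1))
        (b - Complex.I * s * (z - z⁻¹) / 2) (a + s * (z + z⁻¹) / 2 - 1) := by
    rw [← transferForm_mul]
    have e₁ : z * -(a + s * (z + z⁻¹) / 2 + 1) = -(s / 2 * z ^ 2 + (a + 1) * z + s / 2) := by
      field_simp; ring
    have e₂ : z * (b - Complex.I * s * (z - z⁻¹) / 2) =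
        -Complex.I * s / 2 * z ^ 2 + b * z + Complex.I * s / 2 := by
      field_simp; ring
    have e₃ : z * (a + s * (z + z⁻¹) / 2 - 1) = s / 2 * z ^ 2 + (a - 1) * z + s / 2 := by
      field_simp; ring
    rw [e₁, e₂, e₃, hF]
    simp only [transferForm, conicForm, eval_add, eval_sub, eval_mul, eval_neg, eval_pow, eval_C,
      eval_X, eval_ofNat]
  have hF0 : F ≠ 0 := by
    intro h0
    obtain ⟨z, hz, hne⟩ := exists_transferForm_ne_zero (x₂' := x₂') hs h₁₂ h₁ hx₁' hx₂ ht
    have := hev z hz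
    rw [h0, eval_zero, zero_eq_mul] at this
    exact this.elim (pow_ne_zero 4 hz) hne
  have hsub : Z ⊆ F.roots.toFinset := by
    intro z hz
    obtain ⟨hz0, hz⟩ := hZ z hz
    rw [Multiset.mem_toFinset, mem_roots hF0, IsRoot, hev z hz0, hz, mul_zero]
  calc Z.card ≤ _ := Finset.card_le_card hsub
    _ ≤ _ := Multiset.toFinset_card_le _
    _ ≤ _ := card_roots' _
    _ ≤ 8 := by
      apply natDegree_transferForm_le
      · rw [natDegree_neg]; exact natDegree_quadratic_le
      · exact natDegree_quadratic_le
      · exact natDegree_quadratic_le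

end

open Finset in
/-- A chain (or antichain) of pairs meets few cells of a grid. -/
theorem card_cells_le {S : Finset (ℝ × ℝ)} {b : ℝ → ℕ} (hb : Monotone b) {t : ℕ}
    (hbt : ∀ p ∈ S, b p.1 < t ∧ b p.2 < t)
    (hS : (∀ p ∈ S, ∀ q ∈ S, 0 ≤ (p.1 - q.1) * (p.2 - q.2)) ∨
      (∀ p ∈ S, ∀ q ∈ S, (p.1 - q.1) * (p.2 - q.2) ≤ 0)) :
    #(S.image fun p => (b p.1, b p.2)) ≤ 2 * t := by
  rw [← card_range (2 * t)]
  rcases hS with hS | hS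
  · apply card_le_card_of_injOn fun c => c.1 + c.2
    · intro c hc
      simp only [coe_image, Set.mem_image, SetLike.mem_coe] at hc
      obtain ⟨p, hp, rfl⟩ := hc
      have := hbt p hp
      simp only [coe_range, Set.mem_Iio]
      omega
    · intro c hc d hd h
      simp only [coe_image, Set.mem_image, SetLike.mem_coe] at hc hd
      obtain ⟨p, hp, rfl⟩ := hc
      obtain ⟨q, hq, rfl⟩ := hd
      have hpq := hS p hp q hq
      simp only at h
      rcases mul_nonneg_iff.1 hpq with ⟨h₁, h₂⟩ | ⟨h₁, h₂⟩
      · have := hb (sub_nonneg.1 h₁)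
        have := hb (sub_nonneg.1 h₂)
        ext <;> simp only <;> omega
      · have := hb (sub_nonpos.1 h₁)
        have := hb (sub_nonpos.1 h₂)
        ext <;> simp only <;> omega
  · apply card_le_card_of_injOn fun c => c.1 + (t - c.2)
    · intro c hc
      simp only [coe_image, Set.mem_image, SetLike.mem_coe] at hc
      obtain ⟨p, hp, rfl⟩ := hc
      have := hbt p hp
      simp only [coe_range, Set.mem_Iio]
      omega
    · intro c hc d hd h
      simp only [coe_image, Set.mem_image, SetLike.mem_coe] at hc hd
      obtain ⟨p, hp, rfl⟩ := hc
      obtain ⟨q, hq, rfl⟩ := hd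
      have hpq := hS p hp q hq
      have := hbt p hp
      have := hbt q hq
      simp only at h
      rcases mul_nonpos_iff.1 hpq with ⟨h₁, h₂⟩ | ⟨h₁, h₂⟩
      · have := hb (sub_nonneg.1 h₁)
        have := hb (sub_nonpos.1 h₂)
        ext <;> simp only <;> omega
      · have := hb (sub_nonpos.1 h₁)
        have := hb (sub_nonneg.1 h₂)
        ext <;> simp only <;> omega

open Finset in
theorem card_cells_le_of_classes {S : Finset (ℝ × ℝ)} {b : ℝ → ℕ} (hb : Monotone b) {t : ℕ}
    (hbt : ∀ p ∈ S, b p.1 < t ∧ b p.2 < t) (κ : ℝ × ℝ → Bool × Bool)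
    (hS : (∀ p ∈ S, ∀ q ∈ S, κ p = κ q → 0 ≤ (p.1 - q.1) * (p.2 - q.2)) ∨
      (∀ p ∈ S, ∀ q ∈ S, κ p = κ q → (p.1 - q.1) * (p.2 - q.2) ≤ 0)) :
    #(S.image fun p => (b p.1, b p.2)) ≤ 8 * t := by
  classical
  have hsub : (S.image fun p => (b p.1, b p.2)) ⊆
      (univ : Finset (Bool × Bool)).biUnion
        fun k => (S.filter fun p => κ p = k).image fun p => (b p.1, b p.2) := by
    intro c hc
    obtain ⟨p, hp, rfl⟩ := mem_image.1 hc
    exact mem_biUnion.2 ⟨κ p, mem_univ _, mem_image.2 ⟨p, by simp [hp], rfl⟩⟩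
  calc _ ≤ _ := card_le_card hsub
    _ ≤ #(univ : Finset (Bool × Bool)) * (2 * t) := by
      apply card_biUnion_le_card_mul
      intro k _
      apply card_cells_le hb
      · exact fun p hp => hbt p (mem_filter.1 hp).1
      · refine hS.imp (fun h p hp q hq => ?_) (fun h p hp q hq => ?_) <;>
        · rw [mem_filter] at hp hq
          exact h p hp.1 q hq.1 (hp.2.trans hq.2.symm)
    _ = 8 * t := by
      rw [show #(univ : Finset (Bool × Bool)) = 4 from rfl]; ring

open Finset in
/-- An incidence bound for curves with two degrees of freedom and points of a Cartesian product:
`S j` is the set of points of the grid on the `j`-th curve. -/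
theorem sum_card_le {ι : Type*} (J : Finset ι) (X : Finset ℝ) {b : ℝ → ℕ} (hb : Monotone b)
    {t m : ℕ} (hbt : ∀ x ∈ X, b x < t) (hbm : ∀ c, #{x ∈ X | b x = c} ≤ m)
    (S : ι → Finset (ℝ × ℝ)) (hSX : ∀ j ∈ J, S j ⊆ X ×ˢ X) (κ : ι → ℝ × ℝ → Bool × Bool)
    (hκ : ∀ j ∈ J, (∀ p ∈ S j, ∀ q ∈ S j, κ j p = κ j q → 0 ≤ (p.1 - q.1) * (p.2 - q.2)) ∨
      (∀ p ∈ S j, ∀ q ∈ S j, κ j p = κ j q → (p.1 - q.1) * (p.2 - q.2) ≤ 0))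
    (N : ℝ × ℝ → ℝ × ℝ → Prop) [∀ p q, Decidable (N p q)]
    (hN : ∀ j ∈ J, ∀ p ∈ S j, #{q ∈ S j | ¬ N p q} ≤ 4)
    (hN' : ∀ p ∈ X ×ˢ X, ∀ q ∈ X ×ˢ X, N p q → #{j ∈ J | p ∈ S j ∧ q ∈ S j} ≤ 16) :
    ∑ j ∈ J, #(S j) ≤ 32 * t * #J + 16 * (#X * m) ^ 2 := by
  classical
  set cell : ℝ × ℝ → ℕ × ℕ := fun p => (b p.1, b p.2) with hcell
  set E : Finset ((ℝ × ℝ) × (ℝ × ℝ)) :=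
    {pq ∈ (X ×ˢ X) ×ˢ (X ×ˢ X) | cell pq.1 = cell pq.2 ∧ N pq.1 pq.2} with hE
  have hj : ∀ j ∈ J, #(S j) ≤ 32 * t + #{pq ∈ E | pq.1 ∈ S j ∧ pq.2 ∈ S j} := by
    intro j hj
    have hcells : #((S j).image cell) ≤ 8 * t := by
      refine card_cells_le_of_classes hb (fun p hp => ?_) (κ j) (hκ j hj)
      have := mem_product.1 (hSX j hj hp)
      exact ⟨hbt _ this.1, hbt _ this.2⟩
    have hfib : ∀ c ∈ (S j).image cell, #{p ∈ S j | cell p = c} ≤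
        4 + #{pq ∈ {pq ∈ E | pq.1 ∈ S j ∧ pq.2 ∈ S j} | cell pq.1 = c} := by
      intro c _
      by_cases h4 : #{p ∈ S j | cell p = c} ≤ 4
      · omega
      · refine le_trans ?_ (le_add_left (card_image_le (f := Prod.fst)))
        apply card_le_card
        intro p hp
        obtain ⟨q, hq, hqN⟩ : ∃ q ∈ {p ∈ S j | cell p = c}, N p q := by
          by_contra! hcon
          apply h4
          refine le_trans (card_le_card ?_) (hN j hj p (mem_filter.1 hp).1)
          intro q hq
          exact mem_filter.2 ⟨(mem_filter.1 hq).1, hcon q hq⟩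
        rw [mem_filter] at hp hq
        refine mem_image.2 ⟨(p, q), ?_, rfl⟩
        simp only [hE, mem_filter]
        exact ⟨⟨⟨mem_product.2 ⟨hSX j hj hp.1, hSX j hj hq.1⟩, hp.2.trans hq.2.symm, hqN⟩,
          hp.1, hq.1⟩, hp.2⟩
    calc #(S j) = ∑ c ∈ (S j).image cell, #{p ∈ S j | cell p = c} :=
          card_eq_sum_card_image cell (S j)
      _ ≤ ∑ c ∈ (S j).image cell,
          (4 + #{pq ∈ {pq ∈ E | pq.1 ∈ S j ∧ pq.2 ∈ S j} | cell pq.1 = c}) := sum_le_sum hfib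
      _ = #((S j).image cell) * 4 + #{pq ∈ E | pq.1 ∈ S j ∧ pq.2 ∈ S j} := by
          rw [sum_add_distrib, sum_const, smul_eq_mul]
          congr 1
          refine (card_eq_sum_card_fiberwise fun pq hpq => ?_).symm
          have hpq : pq ∈ {pq ∈ E | pq.1 ∈ S j ∧ pq.2 ∈ S j} := hpq
          exact mem_image_of_mem _ (mem_filter.1 hpq).2.1
      _ ≤ _ := by omega
  have hEcard : #E ≤ (#X * m) ^ 2 := by
    calc #E ≤ #((X ×ˢ X).sigma fun p => {x ∈ X | b x = b p.1} ×ˢ {x ∈ X | b x = b p.2}) := by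
          apply card_le_card_of_injOn fun pq => ⟨pq.1, pq.2⟩
          · intro pq hpq
            have hpq : pq ∈ E := hpq
            simp only [hE, hcell, mem_filter, mem_product, Prod.mk.injEq] at hpq
            simp only [coe_sigma, Set.mem_sigma_iff, SetLike.mem_coe, mem_product, mem_filter]
            tauto
          · rintro ⟨p, q⟩ _ ⟨p', q'⟩ _ h
            simpa using h
      _ ≤ ∑ p ∈ X ×ˢ X, m * m := by
          rw [card_sigma]
          refine sum_le_sum fun p _ => ?_
          rw [card_product]
          exact Nat.mul_le_mul (hbm _) (hbm _)
      _ = (#X * m) ^ 2 := by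
          rw [sum_const, card_product, smul_eq_mul]; ring
  calc ∑ j ∈ J, #(S j) ≤ ∑ j ∈ J, (32 * t + #{pq ∈ E | pq.1 ∈ S j ∧ pq.2 ∈ S j}) :=
        sum_le_sum hj
    _ = 32 * t * #J + ∑ pq ∈ E, #{j ∈ J | pq.1 ∈ S j ∧ pq.2 ∈ S j} := by
        rw [sum_add_distrib, sum_const, smul_eq_mul, mul_comm]
        congr 1
        exact sum_card_bipartiteAbove_eq_sum_card_bipartiteBelow _
    _ ≤ 32 * t * #J + #E * 16 := by
        gcongr
        rw [← smul_eq_mul, ← sum_const]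
        refine sum_le_sum fun pq hpq => ?_
        simp only [hE, mem_filter, mem_product] at hpq
        exact hN' _ (mem_product.2 hpq.1.1) _ (mem_product.2 hpq.1.2) hpq.2.2
    _ ≤ _ := by
        rw [mul_comm #E]
        gcongr

open Finset in
theorem exists_blocks (X : Finset ℝ) {m : ℕ} (hm : 0 < m) :
    ∃ b : ℝ → ℕ, Monotone b ∧ (∀ x ∈ X, b x < #X / m + 1) ∧ ∀ c, #{x ∈ X | b x = c} ≤ m := by
  classical
  have hrank : Monotone fun x : ℝ => #{w ∈ X | w < x} := fun x y hxy =>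
    card_le_card fun w hw => by
      rw [mem_filter] at hw ⊢
      exact ⟨hw.1, hw.2.trans_le hxy⟩
  refine ⟨fun x => #{w ∈ X | w < x} / m, fun x y hxy => Nat.div_le_div_right (hrank hxy), ?_, ?_⟩
  · intro x _
    exact Nat.lt_succ_of_le (Nat.div_le_div_right (card_filter_le _ _))
  · intro c
    calc _ ≤ #(Ico (c * m) (c * m + m)) := by
          apply card_le_card_of_injOn fun x => #{w ∈ X | w < x}
          · intro x hx
            have hx : x ∈ {x ∈ X | #{w ∈ X | w < x} / m = c} := hx
            have hx := (mem_filter.1 hx).2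
            simp only [coe_Ico, Set.mem_Ico]
            have h₁ := Nat.div_add_mod (#{w ∈ X | w < x}) m
            have h₂ := Nat.mod_lt (#{w ∈ X | w < x}) hm
            rw [hx, mul_comm] at h₁
            omega
          · have hlt {x y : ℝ} (hx : x ∈ X) (hxy : x < y) :
                #{w ∈ X | w < x} < #{w ∈ X | w < y} := by
              apply card_lt_card
              rw [ssubset_iff_of_subset]
              · exact ⟨x, by simp [hx, hxy], by simp⟩
              · intro w hw
                rw [mem_filter] at hw ⊢
                exact ⟨hw.1, hw.2.trans hxy⟩
            intro x hx y hy h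
            have hx := (mem_filter.1 (mem_coe.1 hx)).1
            have hy := (mem_filter.1 (mem_coe.1 hy)).1
            simp only at h
            rcases lt_trichotomy x y with hxy | hxy | hxy
            · have := hlt hx hxy; omega
            · exact hxy
            · have := hlt hy hxy; omega
      _ = m := by simp

theorem chordForm_comm {K : Type*} [CommRing K] (u v x y : K) :
    chordForm u v x y = chordForm u v y x := by
  unfold chordForm; ring

theorem chordForm_den_ne_zero {K : Type*} [Field K] {u v x y : K} (h : u ^ 2 + v ^ 2 ≠ 1)
    (hy : chordForm u v x y = 0) : v - (u + 1) * x ≠ 0 := by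
  intro h0
  unfold chordForm at hy
  exact h (by linear_combination (u + 1) * hy + (v - (u + 1) * y) * h0)

theorem chordForm_right_unique {K : Type*} [Field K] {u v x y y' : K} (h : u ^ 2 + v ^ 2 ≠ 1)
    (hy : chordForm u v x y = 0) (hy' : chordForm u v x y' = 0) : y = y' := by
  have h0 := chordForm_den_ne_zero h hy
  unfold chordForm at hy hy'
  exact mul_left_cancel₀ h0 (by linear_combination hy - hy')

theorem chordForm_left_unique {K : Type*} [Field K] {u v x x' y : K} (h : u ^ 2 + v ^ 2 ≠ 1)
    (hx : chordForm u v x y = 0) (hx' : chordForm u v x' y = 0) : x = x' := by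
  rw [chordForm_comm] at hx hx'
  exact chordForm_right_unique h hx hx'

theorem chordForm_sub_mul {K : Type*} [CommRing K] {u v x₁ x₂ y₁ y₂ : K}
    (h₁ : chordForm u v x₁ y₁ = 0) (h₂ : chordForm u v x₂ y₂ = 0) :
    (y₂ - y₁) * ((v - (u + 1) * x₁) * (v - (u + 1) * x₂)) =
      (x₂ - x₁) * (1 - u ^ 2 - v ^ 2) := by
  unfold chordForm at h₁ h₂
  linear_combination (v - (u + 1) * x₁) * h₂ - (v - (u + 1) * x₂) * h₁

theorem mul_pos_of_decide_eq {p q : ℝ} (hp : p ≠ 0) (hq : q ≠ 0)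
    (h : decide (0 < p) = decide (0 < q)) : 0 < p * q := by
  rw [decide_eq_decide] at h
  rcases lt_or_gt_of_ne hp with hlt | hlt
  · have : q < 0 := lt_of_le_of_ne (not_lt.1 fun hq' => hlt.not_gt (h.2 hq')) hq
    exact mul_pos_of_neg_of_neg hlt this
  · exact mul_pos hlt (h.1 hlt)

/-- The curve attached to a pair of projection centres is piecewise monotone. -/
theorem chordForm_monotone {u v u' v' x₁ x₁' x₂ x₂' y₁ y₂ : ℝ}
    (h₁ : chordForm u v x₁ y₁ = 0) (h₁' : chordForm u' v' x₁' y₁ = 0)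
    (h₂ : chordForm u v x₂ y₂ = 0) (h₂' : chordForm u' v' x₂' y₂ = 0)
    (hd : 0 < (v - (u + 1) * x₁) * (v - (u + 1) * x₂))
    (hd' : 0 < (v' - (u' + 1) * x₁') * (v' - (u' + 1) * x₂')) :
    0 ≤ ((x₁ - x₂) * (x₁' - x₂')) * ((1 - u ^ 2 - v ^ 2) * (1 - u' ^ 2 - v' ^ 2)) := by
  have e := chordForm_sub_mul h₁ h₂
  have e' := chordForm_sub_mul h₁' h₂'
  calc 0 ≤ (y₂ - y₁) ^ 2 * (((v - (u + 1) * x₁) * (v - (u + 1) * x₂)) *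
        ((v' - (u' + 1) * x₁') * (v' - (u' + 1) * x₂'))) := by positivity
    _ = ((y₂ - y₁) * ((v - (u + 1) * x₁) * (v - (u + 1) * x₂))) *
        ((y₂ - y₁) * ((v' - (u' + 1) * x₁') * (v' - (u' + 1) * x₂'))) := by ring
    _ = _ := by rw [e, e']; ring

theorem ofReal_re_eq_param {z : ℂ} (hz : ‖z‖ = 1) (a s : ℝ) :
    ((a + s * z.re : ℝ) : ℂ) = a + s * (z + z⁻¹) / 2 := by
  rw [Complex.inv_eq_conj hz, Complex.add_conj]
  push_cast; ring

theorem ofReal_im_eq_param {z : ℂ} (hz : ‖z‖ = 1) (b s : ℝ) :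
    ((b + s * z.im : ℝ) : ℂ) = b - Complex.I * s * (z - z⁻¹) / 2 := by
  rw [Complex.inv_eq_conj hz, Complex.sub_conj]
  push_cast; linear_combination (s * z.im : ℂ) * Complex.I_sq

theorem ofReal_chordForm (u v x y : ℝ) :
    ((chordForm u v x y : ℝ) : ℂ) = chordForm (u : ℂ) v x y := by
  unfold chordForm; push_cast; ring

open Finset in
theorem card_chordForm_eq_zero_le_two {a b s : ℝ} (hs : s ≠ 0) {Z : Finset ℂ}
    (hZ : ∀ z ∈ Z, ‖z‖ = 1) (x y : ℝ) :
    #{z ∈ Z | chordForm (a + s * z.re) (b + s * z.im) x y = 0} ≤ 2 := by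
  classical
  refine card_le_two_of_quadratic (p := s / 2 * ((1 - Complex.I * x) * (1 - Complex.I * y)))
    (q := a * (1 - x * y) + b * (x + y) - (1 + x * y))
    (r := s / 2 * ((1 + Complex.I * x) * (1 + Complex.I * y))) _ (Or.inl ?_) ?_
  · simp [hs, one_sub_I_mul_ofReal_ne_zero]
  · intro z hz
    rw [mem_filter] at hz
    have hz1 := hZ z hz.1
    have hz0 : z ≠ 0 := by rintro rfl; simp at hz1
    rw [← mul_chordForm_param _ _ _ _ _ hz0, ← ofReal_re_eq_param hz1, ← ofReal_im_eq_param hz1,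
      ← ofReal_chordForm, hz.2]
    simp

open Finset in
theorem card_tangent_le_two {a b s : ℝ} (hs : s ≠ 0) (X : Finset ℝ) (y : ℝ) :
    #{x ∈ X | (a * (1 - x * y) + b * (x + y) - (1 + x * y)) ^ 2 =
      s ^ 2 * (1 + x ^ 2) * (1 + y ^ 2)} ≤ 2 := by
  classical
  have hk : 0 < s ^ 2 * (1 + y ^ 2) := by positivity
  refine card_le_two_of_quadratic (p := (-a * y + b - y) ^ 2 - s ^ 2 * (1 + y ^ 2))
    (q := 2 * (a + b * y - 1) * (-a * y + b - y))
    (r := (a + b * y - 1) ^ 2 - s ^ 2 * (1 + y ^ 2)) _ ?_ ?_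
  · by_contra! h
    obtain ⟨h₁, h₂, h₃⟩ := h
    rcases mul_eq_zero.1 h₂ with h | h
    · have h : a + b * y - 1 = 0 := by linarith
      rw [h] at h₃; linarith
    · rw [h] at h₁; linarith
  · intro x hx
    linear_combination (mem_filter.1 hx).2

/-- The pairs `(x, x')` which are projected to the same point from two given centres. -/
def transferPairs (a b s : ℝ) (X : Finset ℝ) (w : ℂ × ℂ) : Finset (ℝ × ℝ) :=
  open Classical in
  (X ×ˢ X).filter fun p => p.1 ≠ p.2 ∧
    ∃ y, chordForm (a + s * w.1.re) (b + s * w.1.im) p.1 y = 0 ∧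
      chordForm (a + s * w.2.re) (b + s * w.2.im) p.2 y = 0

open Finset in
theorem sum_card_transferPairs_le {a b s : ℝ} (hs : s ≠ 0) {X : Finset ℝ} {Z : Finset ℂ}
    (hX : ∀ x ∈ X, conicForm a b s 1 (-x) (x ^ 2) ≠ 0) (hZ : ∀ z ∈ Z, ‖z‖ = 1)
    (hZ' : ∀ z ∈ Z, (a + s * z.re) ^ 2 + (b + s * z.im) ^ 2 ≠ 1) {m : ℕ} (hm : 0 < m) :
    ∑ w ∈ Z ×ˢ Z, #(transferPairs a b s X w) ≤
      32 * (#X / m + 1) * #Z ^ 2 + 16 * (#X * m) ^ 2 := by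
  classical
  obtain ⟨c, hc, hc₁, hc₂⟩ := exists_blocks X hm
  rw [sq #Z, ← card_product]
  have huniq : ∀ w ∈ Z ×ˢ Z, ∀ p ∈ transferPairs a b s X w, ∀ q ∈ transferPairs a b s X w,
      p.1 = q.1 → p = q := by
    intro w hw p hp q hq h
    rw [mem_product] at hw
    simp only [transferPairs, mem_filter] at hp hq
    obtain ⟨-, -, y₁, h₁, h₁'⟩ := hp
    obtain ⟨-, -, y₂, h₂, h₂'⟩ := hq
    rw [h] at h₁
    have := chordForm_right_unique (hZ' _ hw.1) h₁ h₂
    subst this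
    exact Prod.ext h (chordForm_left_unique (hZ' _ hw.2) h₁' h₂')
  refine sum_card_le (Z ×ˢ Z) X hc hc₁ hc₂ (transferPairs a b s X)
    (fun w _ => filter_subset _ _)
    (fun w p => (decide (0 < b + s * w.1.im - (a + s * w.1.re + 1) * p.1),
      decide (0 < b + s * w.2.im - (a + s * w.2.re + 1) * p.2))) ?_
    (fun p q => p.1 ≠ q.1 ∧ p.1 ≠ p.2 ∧
      (a * (1 - q.1 * p.2) + b * (q.1 + p.2) - (1 + q.1 * p.2)) ^ 2 ≠
      s ^ 2 * (1 + q.1 ^ 2) * (1 + p.2 ^ 2)) ?_ ?_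
  · intro w hw
    rw [mem_product] at hw
    have key : ∀ p ∈ transferPairs a b s X w, ∀ q ∈ transferPairs a b s X w,
        ((decide (0 < b + s * w.1.im - (a + s * w.1.re + 1) * p.1),
          decide (0 < b + s * w.2.im - (a + s * w.2.re + 1) * p.2)) : Bool × Bool) =
        (decide (0 < b + s * w.1.im - (a + s * w.1.re + 1) * q.1),
          decide (0 < b + s * w.2.im - (a + s * w.2.re + 1) * q.2)) →
        0 ≤ ((p.1 - q.1) * (p.2 - q.2)) *
          ((1 - (a + s * w.1.re) ^ 2 - (b + s * w.1.im) ^ 2) *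
          (1 - (a + s * w.2.re) ^ 2 - (b + s * w.2.im) ^ 2)) := by
      intro p hp q hq h
      simp only [transferPairs, mem_filter] at hp hq
      obtain ⟨-, -, y₁, h₁, h₁'⟩ := hp
      obtain ⟨-, -, y₂, h₂, h₂'⟩ := hq
      rw [Prod.mk.injEq] at h
      apply chordForm_monotone h₁ h₁' h₂ h₂'
      · exact mul_pos_of_decide_eq (chordForm_den_ne_zero (hZ' _ hw.1) h₁)
          (chordForm_den_ne_zero (hZ' _ hw.1) h₂) h.1
      · exact mul_pos_of_decide_eq (chordForm_den_ne_zero (hZ' _ hw.2) h₁')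
          (chordForm_den_ne_zero (hZ' _ hw.2) h₂') h.2
    have hne : (1 - (a + s * w.1.re) ^ 2 - (b + s * w.1.im) ^ 2) *
          (1 - (a + s * w.2.re) ^ 2 - (b + s * w.2.im) ^ 2) ≠ 0 := by
      apply mul_ne_zero
      · intro h; exact hZ' _ hw.1 (by linarith)
      · intro h; exact hZ' _ hw.2 (by linarith)
    rcases lt_or_gt_of_ne hne with h | h
    · exact Or.inr fun p hp q hq hpq => nonpos_of_mul_nonneg_left (key p hp q hq hpq) h
    · exact Or.inl fun p hp q hq hpq => nonneg_of_mul_nonneg_left (key p hp q hq hpq) h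
  · intro w hw p hp
    have hp' : p.1 ≠ p.2 := by
      simp only [transferPairs, mem_filter] at hp
      exact hp.2.1
    calc _ ≤ #({p.1} ∪ {x ∈ X | (a * (1 - x * p.2) + b * (x + p.2) - (1 + x * p.2)) ^ 2 =
          s ^ 2 * (1 + x ^ 2) * (1 + p.2 ^ 2)}) := by
          apply card_le_card_of_injOn Prod.fst
          · intro q hq
            have hq := mem_filter.1 (mem_coe.1 hq)
            have hqX : q.1 ∈ X := by
              have := hq.1
              simp only [transferPairs, mem_filter, mem_product] at this
              exact this.1.1
            have := hq.2
            simp only [coe_union, coe_singleton, Set.mem_union, Set.mem_singleton_iff,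
              SetLike.mem_coe, mem_filter]
            by_contra! hcon
            exact this ⟨fun h => hcon.1 h.symm, hp', hcon.2 hqX⟩
          · intro q hq q' hq' h
            exact huniq w hw _ (mem_filter.1 (mem_coe.1 hq)).1 _ (mem_filter.1 (mem_coe.1 hq')).1 h
      _ ≤ 1 + 2 := (card_union_le _ _).trans
          (add_le_add (card_singleton _).le (card_tangent_le_two hs X p.2))
      _ ≤ 4 := by norm_num
  · rintro p hp q hq ⟨h₁, h₂, h₃⟩
    rw [mem_product] at hp hq
    calc _ ≤ 2 * #(image Prod.fst {w ∈ Z ×ˢ Z | p ∈ transferPairs a b s X w ∧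
          q ∈ transferPairs a b s X w}) := by
          apply card_le_mul_card_image
          intro z hz
          obtain ⟨w, hw, rfl⟩ := mem_image.1 hz
          rw [mem_filter, mem_product] at hw
          obtain ⟨hwZ, hw, -⟩ := hw
          simp only [transferPairs, mem_filter] at hw
          obtain ⟨-, -, y, hy, -⟩ := hw
          refine le_trans ?_ (card_chordForm_eq_zero_le_two (a := a) (b := b) hs hZ p.2 y)
          apply card_le_card_of_injOn Prod.snd
          · intro w' hw'
            rw [mem_coe, mem_filter, mem_filter, mem_product] at hw'
            obtain ⟨⟨hwZ', hw', -⟩, he⟩ := hw'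
            simp only [transferPairs, mem_filter] at hw'
            obtain ⟨-, -, y', h, h'⟩ := hw'
            rw [he] at h
            have := chordForm_right_unique (hZ' _ hwZ.1) hy h
            subst this
            rw [mem_coe, mem_filter]
            exact ⟨hwZ'.2, h'⟩
          · intro w₁ hw₁ w₂ hw₂ h
            exact Prod.ext ((mem_filter.1 (mem_coe.1 hw₁)).2.trans
              (mem_filter.1 (mem_coe.1 hw₂)).2.symm) h
      _ ≤ 2 * 8 := by
          gcongr
          apply card_le_of_transferForm_eq_zero hs h₁ h₂ (hX _ hp.2) (hX _ hq.1) h₃ (x₂' := q.2)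
          intro z hz
          obtain ⟨w, hw, rfl⟩ := mem_image.1 hz
          rw [mem_filter, mem_product] at hw
          obtain ⟨hwZ, hp, hq⟩ := hw
          have hn := hZ _ hwZ.1
          simp only [transferPairs, mem_filter] at hp hq
          obtain ⟨-, -, y₁, h₁, h₁'⟩ := hp
          obtain ⟨-, -, y₂, h₂, h₂'⟩ := hq
          refine ⟨by intro h; simp [h] at hn, ?_⟩
          rw [← ofReal_re_eq_param hn, ← ofReal_im_eq_param hn]
          have hcirc : (a + s * w.2.re - a) ^ 2 + (b + s * w.2.im - b) ^ 2 = s ^ 2 := by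
            have := Complex.sq_norm w.2
            rw [hZ _ hwZ.2, Complex.normSq_apply] at this
            linear_combination -s ^ 2 * this
          have := transferForm_eq_zero h₁ h₁' h₂ h₂' hcirc
          unfold transferForm conicForm at this ⊢
          exact_mod_cast this
      _ = 16 := by norm_num

open Finset in
theorem sq_card_triples_le {a b s : ℝ} (hs : s ≠ 0) {X : Finset ℝ} {Z : Finset ℂ}
    (hX : ∀ x ∈ X, conicForm a b s 1 (-x) (x ^ 2) ≠ 0) (hZ : ∀ z ∈ Z, ‖z‖ = 1)
    (hZ' : ∀ z ∈ Z, (a + s * z.re) ^ 2 + (b + s * z.im) ^ 2 ≠ 1) {m : ℕ} (hm : 0 < m) :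
    (∑ y ∈ X, #{p ∈ X ×ˢ Z | chordForm (a + s * p.2.re) (b + s * p.2.im) p.1 y = 0}) ^ 2 ≤
      #X * (2 * (#X * #Z) + (32 * (#X / m + 1) * #Z ^ 2 + 16 * (#X * m) ^ 2)) := by
  classical
  set T : ℝ → Finset (ℝ × ℂ) :=
    fun y => {p ∈ X ×ˢ Z | chordForm (a + s * p.2.re) (b + s * p.2.im) p.1 y = 0} with hT
  have hsum : ∑ y ∈ X, #(T y) ≤ #X * #Z := by
    calc _ = ∑ p ∈ X ×ˢ Z, #{y ∈ X | chordForm (a + s * p.2.re) (b + s * p.2.im) p.1 y = 0} :=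
          sum_card_bipartiteAbove_eq_sum_card_bipartiteBelow _
      _ ≤ ∑ p ∈ X ×ˢ Z, 1 := by
          refine sum_le_sum fun p hp => card_le_one.2 fun y hy y' hy' => ?_
          rw [mem_product] at hp
          rw [mem_filter] at hy hy'
          exact chordForm_right_unique (hZ' _ hp.2) hy.2 hy'.2
      _ = _ := by simp
  have hdiag : ∑ y ∈ X, #{pq ∈ T y ×ˢ T y | pq.1.1 = pq.2.1} ≤ 2 * (#X * #Z) := by
    calc _ ≤ ∑ y ∈ X, 2 * #(T y) := by
          refine sum_le_sum fun y _ => ?_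
          rw [mul_comm]
          refine card_le_mul_card_image_of_maps_to (f := Prod.fst) (t := T y)
            (fun pq hpq => (mem_product.1 (mem_filter.1 hpq).1).1) 2 ?_ |>.trans_eq (mul_comm _ _)
          intro p hp
          refine le_trans ?_ (card_chordForm_eq_zero_le_two (a := a) (b := b) hs hZ p.1 y)
          apply card_le_card_of_injOn fun pq => pq.2.2
          · intro pq hpq
            simp only [hT, coe_filter, mem_filter, mem_product, Set.mem_ofPred_eq] at hpq ⊢
            obtain ⟨⟨⟨-, ⟨-, hz⟩, h⟩, he⟩, rfl⟩ := hpq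
            rw [he]
            exact ⟨hz, h⟩
          · intro pq hpq pq' hpq' h
            simp only [coe_filter, mem_filter, Set.mem_ofPred_eq] at hpq hpq'
            refine Prod.ext (hpq.2.trans hpq'.2.symm) (Prod.ext ?_ h)
            rw [← hpq.1.2, ← hpq'.1.2, hpq.2, hpq'.2]
      _ ≤ _ := by
          rw [← mul_sum]
          gcongr
  have hoff : ∑ y ∈ X, #{pq ∈ T y ×ˢ T y | ¬ pq.1.1 = pq.2.1} ≤
      ∑ w ∈ Z ×ˢ Z, #(transferPairs a b s X w) := by
    rw [← card_sigma, ← card_sigma]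
    apply card_le_card_of_injOn
      fun e => ⟨(e.2.1.2, e.2.2.2), (e.2.1.1, e.2.2.1)⟩
    · rintro ⟨y, ⟨x, z⟩, ⟨x', z'⟩⟩ h
      simp only [hT, coe_sigma, Set.mem_sigma_iff, SetLike.mem_coe, mem_filter, mem_product] at h
      simp only [transferPairs, coe_sigma, Set.mem_sigma_iff, SetLike.mem_coe, mem_filter,
        mem_product]
      exact ⟨⟨h.2.1.1.1.2, h.2.1.2.1.2⟩, ⟨h.2.1.1.1.1, h.2.1.2.1.1⟩, h.2.2, y, h.2.1.1.2,
        h.2.1.2.2⟩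
    · rintro ⟨y₁, ⟨x, z⟩, ⟨x', z'⟩⟩ h₁ ⟨y₂, ⟨x₂, z₂⟩, ⟨x₂', z₂'⟩⟩ h₂ h
      simp only [Sigma.mk.injEq, Prod.mk.injEq, heq_eq_eq] at h
      obtain ⟨⟨rfl, rfl⟩, rfl, rfl⟩ := h
      simp only [hT, coe_sigma, Set.mem_sigma_iff, SetLike.mem_coe, mem_filter,
        mem_product] at h₁ h₂
      have := chordForm_right_unique (hZ' _ h₁.2.1.1.1.2) h₁.2.1.1.2 h₂.2.1.1.2
      subst this
      rfl
  calc _ ≤ #X * ∑ y ∈ X, #(T y) ^ 2 := sq_sum_le_card_mul_sum_sq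
    _ = #X * (∑ y ∈ X, #{pq ∈ T y ×ˢ T y | pq.1.1 = pq.2.1} +
        ∑ y ∈ X, #{pq ∈ T y ×ˢ T y | ¬ pq.1.1 = pq.2.1}) := by
        rw [← sum_add_distrib]
        congr 1
        refine sum_congr rfl fun y _ => ?_
        rw [card_filter_add_card_filter_not, card_product, sq]
    _ ≤ _ := by
        gcongr
        exact hoff.trans (sum_card_transferPairs_le hs hX hZ hZ' hm)

open Finset in
theorem card_triples_le {a b s : ℝ} (hs : s ≠ 0) {X : Finset ℝ} {Z : Finset ℂ} {n : ℕ}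
    (hX : ∀ x ∈ X, conicForm a b s 1 (-x) (x ^ 2) ≠ 0) (hZ : ∀ z ∈ Z, ‖z‖ = 1)
    (hZ' : ∀ z ∈ Z, (a + s * z.re) ^ 2 + (b + s * z.im) ^ 2 ≠ 1) (hXn : #X ≤ n) (hZn : #Z ≤ n) :
    ((∑ y ∈ X, #{p ∈ X ×ˢ Z | chordForm (a + s * p.2.re) (b + s * p.2.im) p.1 y = 0} : ℕ) : ℝ) ≤
      12 * (n : ℝ) ^ ((11 : ℝ) / 6) := by
  rcases Nat.eq_zero_or_pos n with rfl | hn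
  · rw [card_eq_zero.1 (Nat.le_zero.1 hXn)]
    simp
  set c : ℝ := (n : ℝ) ^ ((1 : ℝ) / 3) with hc
  have hn1 : (1 : ℝ) ≤ n := by exact_mod_cast hn
  have hc1 : 1 ≤ c := Real.one_le_rpow hn1 (by norm_num)
  have hc0 : 0 < c := by linarith
  have hc3 : c ^ 3 = n := by
    rw [hc, ← Real.rpow_natCast, ← Real.rpow_mul (by linarith)]
    norm_num
  have hm : 0 < ⌈c⌉₊ := Nat.ceil_pos.2 hc0
  have hm2 : (⌈c⌉₊ : ℝ) ≤ 2 * c := by linarith [Nat.ceil_lt_add_one hc0.le]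
  have hX' : (#X : ℝ) ≤ c ^ 3 := by rw [hc3]; exact_mod_cast hXn
  have hZ'' : (#Z : ℝ) ≤ c ^ 3 := by rw [hc3]; exact_mod_cast hZn
  have hdiv : ((#X / ⌈c⌉₊ : ℕ) : ℝ) ≤ c ^ 2 := by
    calc ((#X / ⌈c⌉₊ : ℕ) : ℝ) ≤ #X / ⌈c⌉₊ := Nat.cast_div_le
      _ ≤ c ^ 3 / c := by
        gcongr
        exact Nat.le_ceil c
      _ = c ^ 2 := by field_simp
  have hsq := sq_card_triples_le hs hX hZ hZ' hm
  refine (sq_le_sq₀ (Nat.cast_nonneg _) (by positivity)).1 ?_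
  have hpow : ((n : ℝ) ^ ((11 : ℝ) / 6)) ^ 2 = c ^ 11 := by
    rw [hc, ← Real.rpow_natCast, ← Real.rpow_natCast, ← Real.rpow_mul (by linarith),
      ← Real.rpow_mul (by linarith)]
    norm_num
  rw [mul_pow, hpow]
  calc _ ≤ ((#X : ℝ) * (2 * (#X * #Z) + (32 * ((#X / ⌈c⌉₊ : ℕ) + 1) * (#Z : ℝ) ^ 2
        + 16 * (#X * ⌈c⌉₊) ^ 2))) := by exact_mod_cast hsq
    _ ≤ c ^ 3 * (2 * (c ^ 3 * c ^ 3) + (32 * (c ^ 2 + c ^ 2) * (c ^ 3) ^ 2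
        + 16 * (c ^ 3 * (2 * c)) ^ 2)) := by
      gcongr
      exact one_le_pow₀ hc1
    _ = 2 * c ^ 9 + 128 * c ^ 11 := by ring
    _ ≤ 2 * c ^ 11 + 128 * c ^ 11 := by
      gcongr
      norm_num
    _ ≤ 12 ^ 2 * c ^ 11 := by nlinarith [pow_pos hc0 11]

/-- The line through `p` and `q`. -/
def lineThrough (p q : ℂ) : Set ℂ :=
  {z : ℂ | ∃ t : ℝ, z = p + t • (q - p)}

theorem IsLine.eq_lineThrough {L : Set ℂ} (hL : IsLine L) {p q : ℂ} (hp : p ∈ L) (hq : q ∈ L)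
    (hpq : p ≠ q) : L = lineThrough p q := by
  obtain ⟨a, d, -, rfl⟩ := hL
  obtain ⟨t₁, rfl⟩ := hp
  obtain ⟨t₂, rfl⟩ := hq
  have ht : t₂ - t₁ ≠ 0 := by
    intro h
    apply hpq
    rw [sub_eq_zero.1 h]
  have htC : (t₂ : ℂ) - t₁ ≠ 0 := by exact_mod_cast ht
  ext z
  constructor
  · rintro ⟨t, rfl⟩
    refine ⟨(t - t₁) / (t₂ - t₁), ?_⟩
    simp only [Complex.real_smul]
    push_cast
    field_simp
    ring
  · rintro ⟨t, rfl⟩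
    refine ⟨t₁ + t * (t₂ - t₁), ?_⟩
    simp only [Complex.real_smul]
    push_cast
    ring

theorem IsLine.not_three_mem_sphere {L : Set ℂ} (hL : IsLine L) {p q r c : ℂ} {ρ : ℝ}
    (hp : p ∈ L) (hq : q ∈ L) (hr : r ∈ L) (hpq : p ≠ q) (hpr : p ≠ r) (hqr : q ≠ r)
    (hpc : p ∈ Metric.sphere c ρ) (hqc : q ∈ Metric.sphere c ρ) :
    r ∉ Metric.sphere c ρ := by
  intro hrc
  obtain ⟨a, d, hd, rfl⟩ := hL
  obtain ⟨t₁, rfl⟩ := hp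
  obtain ⟨t₂, rfl⟩ := hq
  obtain ⟨t₃, rfl⟩ := hr
  have h₁₂ : t₁ - t₂ ≠ 0 := fun h => hpq (by rw [sub_eq_zero.1 h])
  have h₁₃ : t₁ - t₃ ≠ 0 := fun h => hpr (by rw [sub_eq_zero.1 h])
  have h₂₃ : t₂ - t₃ ≠ 0 := fun h => hqr (by rw [sub_eq_zero.1 h])
  have key {t : ℝ} (ht : a + t • d ∈ Metric.sphere c ρ) :
      (a.re + t * d.re - c.re) ^ 2 + (a.im + t * d.im - c.im) ^ 2 = ρ ^ 2 := by
    rw [mem_sphere_iff_norm] at ht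
    rw [← ht, Complex.sq_norm, Complex.normSq_apply]
    simp
    ring
  have k₁ := key hpc
  have k₂ := key hqc
  have k₃ := key hrc
  have e₁₂ : (t₁ + t₂) * (d.re ^ 2 + d.im ^ 2) +
      2 * (d.re * (a.re - c.re) + d.im * (a.im - c.im)) = 0 :=
    mul_left_cancel₀ h₁₂ (by linear_combination k₁ - k₂)
  have e₁₃ : (t₁ + t₃) * (d.re ^ 2 + d.im ^ 2) +
      2 * (d.re * (a.re - c.re) + d.im * (a.im - c.im)) = 0 :=
    mul_left_cancel₀ h₁₃ (by linear_combination k₁ - k₃)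
  have e : d.re ^ 2 + d.im ^ 2 = 0 :=
    mul_left_cancel₀ h₂₃ (by linear_combination e₁₂ - e₁₃)
  apply hd
  apply Complex.ext
  · simp only [Complex.zero_re]; nlinarith [sq_nonneg d.re, sq_nonneg d.im]
  · simp only [Complex.zero_im]; nlinarith [sq_nonneg d.re, sq_nonneg d.im]

open Finset in
theorem card_le_two_of_mem_spheres {c₁ c₂ : ℂ} {ρ₁ ρ₂ : ℝ} (h : ¬ (c₁ = c₂ ∧ ρ₁ = ρ₂))
    (S : Finset ℂ) (hS : ∀ p ∈ S, p ∈ Metric.sphere c₁ ρ₁ ∧ p ∈ Metric.sphere c₂ ρ₂) :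
    #S ≤ 2 := by
  by_contra! hcard
  obtain ⟨p, q, r, hp, hq, hr, hpq, hpr, hqr⟩ := two_lt_card_iff.1 hcard
  have hc : c₁ ≠ c₂ := by
    rintro rfl
    exact h ⟨rfl, (hS p hp).1.symm.trans (hS p hp).2⟩
  rcases EuclideanGeometry.eq_of_dist_eq_of_dist_eq_of_finrank_eq_two
    Complex.finrank_real_complex hc hpq (hS p hp).1 (hS q hq).1 (hS r hr).1 (hS p hp).2
    (hS q hq).2 (hS r hr).2 with h | h
  · exact hpr h.symm
  · exact hqr h.symm

/-- Half-angle parametrisation of the unit circle minus `-1`. -/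
def unitPoint (x : ℝ) : ℂ :=
  ⟨(1 - x ^ 2) / (1 + x ^ 2), 2 * x / (1 + x ^ 2)⟩

/-- The tangent of half the argument of a point of the unit circle. -/
def halfTan (w : ℂ) : ℝ :=
  w.im / (1 + w.re)

theorem unitPoint_halfTan {w : ℂ} (hw : ‖w‖ = 1) (hw' : w ≠ -1) : unitPoint (halfTan w) = w := by
  have h := Complex.sq_norm w
  rw [hw, Complex.normSq_apply] at h
  have h0 : 1 + w.re ≠ 0 := by
    intro h0
    apply hw'
    have hre : w.re = -1 := by linarith
    apply Complex.ext
    · simpa using hre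
    · rw [hre] at h
      have : w.im ^ 2 = 0 := by linarith
      simpa using this
  have hden : 1 + halfTan w ^ 2 = 2 / (1 + w.re) := by
    unfold halfTan
    field_simp
    linear_combination -h
  unfold unitPoint
  apply Complex.ext
  · simp only
    rw [hden]
    unfold halfTan
    field_simp
    linear_combination h
  · simp only
    rw [hden]
    unfold halfTan
    field_simp

theorem chordForm_eq_zero_of_collinear {x y t₁ t₂ t₃ : ℝ} {A D r : ℂ} (hxy : x ≠ y)
    (hx : unitPoint x = A + t₁ • D) (hy : unitPoint y = A + t₂ • D) (hr : r = A + t₃ • D) :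
    chordForm r.re r.im x y = 0 := by
  have hx0 : 1 + x ^ 2 ≠ 0 := by positivity
  have hy0 : 1 + y ^ 2 ≠ 0 := by positivity
  have h₁ := congrArg Complex.re hx
  have h₂ := congrArg Complex.im hx
  have h₃ := congrArg Complex.re hy
  have h₄ := congrArg Complex.im hy
  have h₅ := congrArg Complex.re hr
  have h₆ := congrArg Complex.im hr
  simp only [unitPoint, Complex.add_re, Complex.add_im, Complex.real_smul, Complex.mul_re,
    Complex.mul_im, Complex.ofReal_re, Complex.ofReal_im, zero_mul, sub_zero, add_zero]
    at h₁ h₂ h₃ h₄ h₅ h₆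
  have hcross : ((1 - y ^ 2) / (1 + y ^ 2) - (1 - x ^ 2) / (1 + x ^ 2)) *
      (r.im - 2 * x / (1 + x ^ 2)) =
      (2 * y / (1 + y ^ 2) - 2 * x / (1 + x ^ 2)) * (r.re - (1 - x ^ 2) / (1 + x ^ 2)) := by
    rw [h₁, h₂, h₃, h₄, h₅, h₆]
    ring
  field_simp at hcross
  unfold chordForm
  apply mul_left_cancel₀ (sub_ne_zero.2 hxy)
  apply mul_left_cancel₀ hx0
  linear_combination hcross / 2

theorem conicForm_unitPoint (a b s x : ℝ) :
    conicForm a b s 1 (-x) (x ^ 2) = (1 + x ^ 2) ^ 2 * (‖unitPoint x - ⟨a, b⟩‖ ^ 2 - s ^ 2) := by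
  have hx : 1 + x ^ 2 ≠ 0 := by positivity
  rw [Complex.sq_norm, Complex.normSq_apply]
  simp only [unitPoint, conicForm, Complex.sub_re, Complex.sub_im]
  field_simp
  ring

/-- The lines meeting `P` in two points of the first circle and in a point of the second circle
off the first. -/
def mixedLines (P : Finset ℂ) (c₁ c₂ : ℂ) (ρ₁ ρ₂ : ℝ) : Set (Set ℂ) :=
  {L | IsLine L ∧ ∃ p ∈ P, ∃ q ∈ P, ∃ r ∈ P, p ≠ q ∧ p ∈ Metric.sphere c₁ ρ₁ ∧
    q ∈ Metric.sphere c₁ ρ₁ ∧ r ∈ Metric.sphere c₂ ρ₂ ∧ r ∉ Metric.sphere c₁ ρ₁ ∧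
    p ∈ L ∧ q ∈ L ∧ r ∈ L}

theorem norm_sub_div_eq_one {c p : ℂ} {ρ : ℝ} (hρ : 0 < ρ) :
    ‖(p - c) / ρ‖ = 1 ↔ p ∈ Metric.sphere c ρ := by
  rw [norm_div, Complex.norm_of_nonneg hρ.le, div_eq_one_iff_eq hρ.ne', mem_sphere_iff_norm]

theorem unitPoint_halfTan_sub_div {c p : ℂ} {ρ : ℝ} (hρ : 0 < ρ) (hp : p ∈ Metric.sphere c ρ)
    (hp' : p ≠ c - ρ) : unitPoint (halfTan ((p - c) / ρ)) = (p - c) / ρ := by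
  refine unitPoint_halfTan ((norm_sub_div_eq_one hρ).2 hp) fun h => hp' ?_
  rw [div_eq_iff (by exact_mod_cast hρ.ne')] at h
  linear_combination h

open Finset in
theorem mixedLines_finite_and_ncard_le {P : Finset ℂ} {c₁ c₂ : ℂ} {ρ₁ ρ₂ : ℝ} (hρ₁ : 0 < ρ₁)
    (hρ₂ : 0 < ρ₂) :
    (mixedLines P c₁ c₂ ρ₁ ρ₂).Finite ∧
      ((mixedLines P c₁ c₂ ρ₁ ρ₂).ncard : ℝ) ≤ 3 * #P + 12 * (#P : ℝ) ^ ((11 : ℝ) / 6) := by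
  classical
  by_cases hσ : c₁ = c₂ ∧ ρ₁ = ρ₂
  · obtain ⟨rfl, rfl⟩ := hσ
    have hempty : mixedLines P c₁ c₁ ρ₁ ρ₁ = ∅ := by
      refine Set.eq_empty_of_forall_notMem ?_
      rintro L ⟨-, p, -, q, -, r, -, -, -, -, h, h', -⟩
      exact h' h
    rw [hempty]
    simp only [Set.finite_empty, Set.ncard_empty, Nat.cast_zero, true_and]
    positivity
  have hρC : (ρ₁ : ℂ) ≠ 0 := by exact_mod_cast hρ₁.ne'
  have hρC₂ : (ρ₂ : ℂ) ≠ 0 := by exact_mod_cast hρ₂.ne'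
  set a : ℝ := ((c₂ - c₁) / ρ₁).re with ha
  set b : ℝ := ((c₂ - c₁) / ρ₁).im with hb
  set s : ℝ := ρ₂ / ρ₁ with hs
  have hs0 : 0 < s := div_pos hρ₂ hρ₁
  set S : Finset ℂ := insert (c₁ - ρ₁)
    {p ∈ P | p ∈ Metric.sphere c₁ ρ₁ ∧ p ∈ Metric.sphere c₂ ρ₂} with hS
  have hScard : #S ≤ 3 := (card_insert_le _ _).trans
    (Nat.succ_le_succ (card_le_two_of_mem_spheres hσ _ fun p hp => (mem_filter.1 hp).2))
  set f : ℂ → ℝ := fun p => halfTan ((p - c₁) / ρ₁) with hf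
  set X : Finset ℝ := image f {p ∈ P | p ∈ Metric.sphere c₁ ρ₁ ∧ p ∉ S} with hX
  set Z : Finset ℂ := image (fun r => (r - c₂) / ρ₂)
    {r ∈ P | r ∈ Metric.sphere c₂ ρ₂ ∧ r ∉ Metric.sphere c₁ ρ₁} with hZ
  have hXP : #X ≤ #P := card_image_le.trans (card_filter_le _ _)
  have hZP : #Z ≤ #P := card_image_le.trans (card_filter_le _ _)
  have hf' : ∀ p ∈ Metric.sphere c₁ ρ₁, p ∉ S → unitPoint (f p) = (p - c₁) / ρ₁ := by
    intro p hp hpS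
    exact unitPoint_halfTan_sub_div hρ₁ hp fun h => hpS (h ▸ mem_insert_self _ _)
  have hXconic : ∀ x ∈ X, conicForm a b s 1 (-x) (x ^ 2) ≠ 0 := by
    intro x hx
    obtain ⟨p, hp, rfl⟩ := mem_image.1 hx
    obtain ⟨hpP, hp₁, hpS⟩ := mem_filter.1 hp
    rw [conicForm_unitPoint, hf' p hp₁ hpS]
    have hsub : (p - c₁) / ρ₁ - ⟨a, b⟩ = (p - c₂) / ρ₁ := by
      rw [ha, hb, Complex.eta, ← sub_div]
      congr 1
      ring
    rw [hsub, norm_div, Complex.norm_of_nonneg hρ₁.le, hs]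
    refine mul_ne_zero (by positivity) (sub_ne_zero.2 fun h => hpS ?_)
    refine mem_insert_of_mem (mem_filter.2 ⟨hpP, hp₁, mem_sphere_iff_norm.2 ?_⟩)
    rwa [sq_eq_sq₀ (by positivity) (by positivity), div_left_inj' hρ₁.ne'] at h
  have hzpt : ∀ r : ℂ, (⟨a + s * ((r - c₂) / ρ₂).re, b + s * ((r - c₂) / ρ₂).im⟩ : ℂ) =
      (r - c₁) / ρ₁ := by
    intro r
    have : (r - c₁) / ρ₁ = (c₂ - c₁) / ρ₁ + (s : ℂ) * ((r - c₂) / ρ₂) := by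
      rw [hs]
      push_cast
      field_simp
      ring
    rw [this]
    apply Complex.ext <;> simp [ha, hb]
  have hZnorm : ∀ z ∈ Z, ‖z‖ = 1 := by
    intro z hz
    obtain ⟨r, hr, rfl⟩ := mem_image.1 hz
    exact (norm_sub_div_eq_one hρ₂).2 (mem_filter.1 hr).2.1
  have hZcircle : ∀ z ∈ Z, (a + s * z.re) ^ 2 + (b + s * z.im) ^ 2 ≠ 1 := by
    intro z hz h
    obtain ⟨r, hr, rfl⟩ := mem_image.1 hz
    apply (mem_filter.1 hr).2.2
    rw [← norm_sub_div_eq_one hρ₁, ← hzpt, ← sq_eq_sq₀ (norm_nonneg _) zero_le_one,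
      Complex.sq_norm, Complex.normSq_mk, ← sq, ← sq, h, one_pow]
  set T : ℝ → Finset (ℝ × ℂ) := fun y =>
    {p ∈ X ×ˢ Z | chordForm (a + s * p.2.re) (b + s * p.2.im) p.1 y = 0} with hT
  set F : Finset (Set ℂ) := image (fun w : ℂ × ℂ => lineThrough w.1 w.2) (S ×ˢ P) ∪
    image (fun w : (_ : ℝ) × ℝ × ℂ => lineThrough (c₁ + ρ₁ * unitPoint w.2.1)
      (c₁ + ρ₁ * unitPoint w.1)) (X.sigma T) with hF
  have hsub : mixedLines P c₁ c₂ ρ₁ ρ₂ ⊆ F := by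
    rintro L ⟨hL, p, hp, q, hq, r, hr, hpq, hp₁, hq₁, hr₂, hr₁, hpL, hqL, hrL⟩
    rw [mem_coe, hF, mem_union, mem_image, mem_image]
    by_cases hpS : p ∈ S
    · exact Or.inl ⟨(p, q), mem_product.2 ⟨hpS, hq⟩, (hL.eq_lineThrough hpL hqL hpq).symm⟩
    by_cases hqS : q ∈ S
    · exact Or.inl ⟨(q, p), mem_product.2 ⟨hqS, hp⟩, (hL.eq_lineThrough hqL hpL hpq.symm).symm⟩
    have hpf := hf' p hp₁ hpS
    have hqf := hf' q hq₁ hqS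
    refine Or.inr ⟨⟨f q, f p, (r - c₂) / ρ₂⟩, ?_, ?_⟩
    · refine mem_sigma.2 ⟨mem_image_of_mem _ (mem_filter.2 ⟨hq, hq₁, hqS⟩), mem_filter.2
        ⟨mem_product.2 ⟨mem_image_of_mem _ (mem_filter.2 ⟨hp, hp₁, hpS⟩),
          mem_image_of_mem _ (mem_filter.2 ⟨hr, hr₂, hr₁⟩)⟩, ?_⟩⟩
      have hne : f p ≠ f q := by
        intro h
        rw [h, hqf, div_left_inj' hρC, sub_left_inj] at hpf
        exact hpq hpf.symm
      obtain ⟨A, D, -, rfl⟩ := hL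
      obtain ⟨t₁, ht₁⟩ := hpL
      obtain ⟨t₂, ht₂⟩ := hqL
      obtain ⟨t₃, ht₃⟩ := hrL
      have hscale {w : ℂ} {t : ℝ} (h : w = A + t • D) :
          (w - c₁) / ρ₁ = (A - c₁) / ρ₁ + t • (D / ρ₁) := by
        rw [h, Complex.real_smul, Complex.real_smul]
        ring
      have key := chordForm_eq_zero_of_collinear hne (hpf.trans (hscale ht₁))
        (hqf.trans (hscale ht₂)) (hscale ht₃)
      rwa [← hzpt r] at key
    · simp only [hpf, hqf]
      rw [mul_div_cancel₀ _ hρC, mul_div_cancel₀ _ hρC, add_sub_cancel, add_sub_cancel]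
      exact (hL.eq_lineThrough hpL hqL hpq).symm
  refine ⟨F.finite_toSet.subset hsub, ?_⟩
  have hcard : (mixedLines P c₁ c₂ ρ₁ ρ₂).ncard ≤ 3 * #P + ∑ y ∈ X, #(T y) := by
    calc (mixedLines P c₁ c₂ ρ₁ ρ₂).ncard ≤ #F := by
          rw [← Set.ncard_coe_finset F]
          exact Set.ncard_le_ncard hsub F.finite_toSet
      _ ≤ #(S ×ˢ P) + #(X.sigma T) :=
          (card_union_le _ _).trans (add_le_add card_image_le card_image_le)
      _ ≤ 3 * #P + ∑ y ∈ X, #(T y) := by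
          rw [card_product, card_sigma]
          gcongr
  calc ((mixedLines P c₁ c₂ ρ₁ ρ₂).ncard : ℝ) ≤ ((3 * #P + ∑ y ∈ X, #(T y) : ℕ) : ℝ) := by
        exact_mod_cast hcard
    _ = 3 * #P + ((∑ y ∈ X, #(T y) : ℕ) : ℝ) := by push_cast; ring
    _ ≤ _ := by
        gcongr
        exact card_triples_le hs0.ne' hXconic hZnorm hZcircle hXP hZP

theorem mem_mixedLines_of_three_le_ncard {P : Finset ℂ} {c₁ c₂ : ℂ} {ρ₁ ρ₂ : ℝ}
    (hP : (P : Set ℂ) ⊆ Metric.sphere c₁ ρ₁ ∪ Metric.sphere c₂ ρ₂) {L : Set ℂ} (hL : IsLine L)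
    (hcard : 3 ≤ (L ∩ (P : Set ℂ)).ncard) :
    L ∈ mixedLines P c₁ c₂ ρ₁ ρ₂ ∪ mixedLines P c₂ c₁ ρ₂ ρ₁ := by
  obtain ⟨p, q, r, ⟨hpL, hp⟩, ⟨hqL, hq⟩, ⟨hrL, hr⟩, hpq, hpr, hqr⟩ :=
    (Set.two_lt_ncard_iff (P.finite_toSet.inter_of_right L)).1 hcard
  have key {c c' : ℂ} {ρ ρ' : ℝ}
      (hP : (P : Set ℂ) ⊆ Metric.sphere c ρ ∪ Metric.sphere c' ρ') {p q r : ℂ}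
      (hpL : p ∈ L) (hqL : q ∈ L) (hrL : r ∈ L) (hp : p ∈ P) (hq : q ∈ P) (hr : r ∈ P)
      (hpq : p ≠ q) (hpr : p ≠ r) (hqr : q ≠ r) (hpc : p ∈ Metric.sphere c ρ)
      (hqc : q ∈ Metric.sphere c ρ) : L ∈ mixedLines P c c' ρ ρ' := by
    have hrc := hL.not_three_mem_sphere hpL hqL hrL hpq hpr hqr hpc hqc
    exact ⟨hL, p, hp, q, hq, r, hr, hpq, hpc, hqc, (hP hr).resolve_left hrc, hrc, hpL, hqL, hrL⟩
  have hP' := hP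
  rw [Set.union_comm] at hP'
  rcases hP hp with hpσ | hpσ <;> rcases hP hq with hqσ | hqσ
  · exact Or.inl (key hP hpL hqL hrL hp hq hr hpq hpr hqr hpσ hqσ)
  · rcases hP hr with hrσ | hrσ
    · exact Or.inl (key hP hpL hrL hqL hp hr hq hpr hpq hqr.symm hpσ hrσ)
    · exact Or.inr (key hP' hqL hrL hpL hq hr hp hqr hpq.symm hpr.symm hqσ hrσ)
  · rcases hP hr with hrσ | hrσ
    · exact Or.inl (key hP hqL hrL hpL hq hr hp hqr hpq.symm hpr.symm hqσ hrσ)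
    · exact Or.inr (key hP' hpL hrL hqL hp hr hq hpr hpq hqr.symm hpσ hrσ)
  · exact Or.inr (key hP' hpL hqL hrL hp hq hr hpq hpr hqr hpσ hqσ)

/-- A set of `n` points contained in the union of two circles spans at most
`C·n^{11/6}` lines with at least three points. -/
theorem lines_on_two_circles :
    ∃ C : ℝ, ∀ P : Finset ℂ,
      (∃ σ₁ σ₂ : Set ℂ, IsCircle σ₁ ∧ IsCircle σ₂ ∧ (P : Set ℂ) ⊆ σ₁ ∪ σ₂) →
      (({L : Set ℂ | IsLine L ∧ 3 ≤ (L ∩ (P : Set ℂ)).ncard}).ncard : ℝ) ≤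
        C * (P.card : ℝ) ^ ((11 : ℝ) / 6) := by
  refine ⟨30, ?_⟩
  rintro P ⟨σ₁, σ₂, ⟨c₁, ρ₁, hρ₁, rfl⟩, ⟨c₂, ρ₂, hρ₂, rfl⟩, hP⟩
  obtain ⟨hfin, hle⟩ := mixedLines_finite_and_ncard_le (P := P) (c₁ := c₁) (c₂ := c₂) hρ₁ hρ₂
  obtain ⟨hfin', hle'⟩ := mixedLines_finite_and_ncard_le (P := P) (c₁ := c₂) (c₂ := c₁) hρ₂ hρ₁
  have hncard := (Set.ncard_le_ncard
    (fun L (hL : L ∈ {L : Set ℂ | IsLine L ∧ 3 ≤ (L ∩ (P : Set ℂ)).ncard}) =>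
      mem_mixedLines_of_three_le_ncard hP hL.1 hL.2) (hfin.union hfin')).trans
    (Set.ncard_union_le _ _)
  have hpow : (P.card : ℝ) ≤ (P.card : ℝ) ^ ((11 : ℝ) / 6) := by
    rcases Nat.eq_zero_or_pos P.card with h | h
    · rw [h]
      simp
    · exact Real.self_le_rpow_of_one_le (by exact_mod_cast h) (by norm_num)
  have hcast := (Nat.cast_le (α := ℝ)).2 hncard
  push_cast at hcast
  linarith
end
end

section
/- Let K ≥ 1 and n ≥ 2K + 4 be integers. If P is a set of n points in ℝ² such that some line contains exactly n − K points of P, then P determines at least (n−1)(n−2)/2 ordinary circles. -/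
noncomputable section

theorem IsCircle.eq_of_three_mem {C C' : Set ℂ} (hC : IsCircle C) (hC' : IsCircle C')
    {x y z : ℂ} (hxy : x ≠ y) (hxz : x ≠ z) (hyz : y ≠ z)
    (hx : x ∈ C) (hy : y ∈ C) (hz : z ∈ C) (hx' : x ∈ C') (hy' : y ∈ C') (hz' : z ∈ C') :
    C = C' := by
  obtain ⟨c, ρ, -, rfl⟩ := hC
  obtain ⟨c', ρ', -, rfl⟩ := hC'
  by_contra hne
  have hs : (⟨c, ρ⟩ : EuclideanGeometry.Sphere ℂ) ≠ ⟨c', ρ'⟩ := by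
    intro h
    rw [EuclideanGeometry.Sphere.mk.injEq] at h
    exact hne (by rw [h.1, h.2])
  rcases EuclideanGeometry.eq_of_mem_sphere_of_mem_sphere_of_finrank_eq_two
    Complex.finrank_real_complex hs hxy (p := z) hx hy hz hx' hy' hz' with h | h
  · exact hxz h.symm
  · exact hyz h.symm

theorem IsLine.collinear {L : Set ℂ} (hL : IsLine L) : Collinear ℝ L := by
  obtain ⟨a, d, -, rfl⟩ := hL
  rw [collinear_iff_exists_forall_eq_smul_vadd]
  refine ⟨a, d, ?_⟩
  rintro _ ⟨t, rfl⟩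
  exact ⟨t, by simp [add_comm]⟩

theorem IsCircle.eq_or_eq_of_mem_line {C L : Set ℂ} (hC : IsCircle C) (hL : IsLine L)
    {x y z : ℂ} (hxy : x ≠ y) (hx : x ∈ C) (hy : y ∈ C) (hz : z ∈ C)
    (hxL : x ∈ L) (hyL : y ∈ L) (hzL : z ∈ L) : z = x ∨ z = y := by
  obtain ⟨c, ρ, -, rfl⟩ := hC
  by_contra! h
  have hcos : EuclideanGeometry.Cospherical ({x, y, z} : Set ℂ) := by
    refine ⟨c, ρ, ?_⟩
    rintro p (rfl | rfl | rfl) <;> assumption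
  have hind := hcos.affineIndependent_of_ne hxy h.1.symm h.2.symm
  rw [affineIndependent_iff_not_collinear_set] at hind
  refine hind (hL.collinear.subset ?_)
  rintro p (rfl | rfl | rfl) <;> assumption

theorem IsLine.mem_of_collinear {L : Set ℂ} (hL : IsLine L) {x y p : ℂ} (hxy : x ≠ y)
    (hx : x ∈ L) (hy : y ∈ L) (h : Collinear ℝ {x, y, p}) : p ∈ L := by
  obtain ⟨a, d, -, rfl⟩ := hL
  obtain ⟨s, rfl⟩ := hx
  obtain ⟨t, rfl⟩ := hy
  have hp := h.mem_affineSpan_of_mem_of_ne (p₃ := p) (by simp) (by simp) (by simp) hxy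
  rw [mem_affineSpan_pair_iff_exists_lineMap_eq] at hp
  obtain ⟨r, rfl⟩ := hp
  refine ⟨s + r * (t - s), ?_⟩
  simp [AffineMap.lineMap_apply]
  ring

theorem IsLine.exists_isCircle {L : Set ℂ} (hL : IsLine L) {x y p : ℂ} (hxy : x ≠ y)
    (hx : x ∈ L) (hy : y ∈ L) (hp : p ∉ L) :
    ∃ C, IsCircle C ∧ p ∈ C ∧ x ∈ C ∧ y ∈ C := by
  have hind : AffineIndependent ℝ ![x, y, p] := by
    rw [affineIndependent_iff_not_collinear_set]
    exact fun h => hp (hL.mem_of_collinear hxy hx hy h)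
  obtain ⟨S, ⟨-, hS⟩, -⟩ := hind.existsUnique_dist_eq
  have hxS : x ∈ Metric.sphere S.center S.radius := hS ⟨0, rfl⟩
  have hyS : y ∈ Metric.sphere S.center S.radius := hS ⟨1, rfl⟩
  refine ⟨_, ⟨S.center, S.radius, ?_, rfl⟩, hS ⟨2, rfl⟩, hxS, hyS⟩
  rw [Metric.mem_sphere] at hxS hyS
  refine lt_of_le_of_ne (hxS ▸ dist_nonneg) fun h => hxy ?_
  rw [← h, dist_eq_zero] at hxS hyS
  rw [hxS, hyS]

theorem finite_ordinaryCircles (P : Finset ℂ) :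
    {C : Set ℂ | IsCircle C ∧ (C ∩ P).ncard = 3}.Finite := by
  refine Set.Finite.of_injOn (f := fun C => C ∩ (P : Set ℂ)) (t := 𝒫 (P : Set ℂ))
    (fun C _ => Set.inter_subset_right) ?_ P.finite_toSet.powerset
  rintro C ⟨hC, h3⟩ C' ⟨hC', -⟩ h
  obtain ⟨x, y, z, hxy, hxz, hyz, he⟩ := Set.ncard_eq_three.1 h3
  have hsub : ∀ w ∈ ({x, y, z} : Set ℂ), w ∈ C ∧ w ∈ C' := fun w hw =>
    ⟨(he.symm.subset hw).1, (h.subset (he.symm.subset hw)).1⟩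
  obtain ⟨hx, hx'⟩ := hsub x (by simp)
  obtain ⟨hy, hy'⟩ := hsub y (by simp)
  obtain ⟨hz, hz'⟩ := hsub z (by simp)
  exact hC.eq_of_three_mem hC' hxy hxz hyz hx hy hz hx' hy' hz'

/-- Each pair of points off the line loses at most one circle for every point on the line. -/
theorem card_mul_le_two_mul_ordinaryCircles {L : Set ℂ} (hL : IsLine L) (Q A : Finset ℂ)
    (hQ : ∀ p ∈ Q, p ∉ L) (hA : ∀ s ∈ A, s ∈ L) :
    (Q ×ˢ A.offDiag).card ≤
      2 * ordinaryCircles ((Q ∪ A : Finset ℂ) : Set ℂ) + (Q.offDiag ×ˢ A).card := by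
  classical
  have hex : ∀ i : ℂ × ℂ × ℂ, ∃ C, i ∈ Q ×ˢ A.offDiag →
      IsCircle C ∧ i.1 ∈ C ∧ i.2.1 ∈ C ∧ i.2.2 ∈ C := by
    intro i
    by_cases hi : i ∈ Q ×ˢ A.offDiag
    · have hi' := hi
      simp only [Finset.mem_product, Finset.mem_offDiag] at hi'
      obtain ⟨C, hC⟩ := hL.exists_isCircle hi'.2.2.2 (hA _ hi'.2.1) (hA _ hi'.2.2.1) (hQ _ hi'.1)
      exact ⟨C, fun _ => hC⟩
    · exact ⟨∅, fun h => absurd h hi⟩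
  choose circ hcirc using hex
  set ordinary : ℂ × ℂ × ℂ → Prop := fun i => ∀ q ∈ Q, q ∈ circ i → q = i.1 with hord
  rw [← Finset.card_filter_add_card_filter_not ordinary]
  refine Nat.add_le_add ?_ ?_
  · set P : Finset ℂ := Q ∪ A with hP
    have hfin := finite_ordinaryCircles P
    rw [ordinaryCircles, Set.ncard_eq_toFinset_card _ hfin]
    refine Finset.card_le_mul_card_image_of_maps_to (f := circ) ?_ 2 ?_
    · rintro ⟨p, s, t⟩ hi
      rw [Finset.mem_filter] at hi
      obtain ⟨hi, hio⟩ := hi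
      obtain ⟨hC, hp, hs, ht⟩ := hcirc _ hi
      simp only [Finset.mem_product, Finset.mem_offDiag] at hi
      obtain ⟨hpQ, hsA, htA, hst⟩ := hi
      rw [Set.Finite.mem_toFinset]
      refine ⟨hC, Set.ncard_eq_three.2 ⟨p, s, t, ?_, ?_, hst, ?_⟩⟩
      · rintro rfl; exact hQ _ hpQ (hA _ hsA)
      · rintro rfl; exact hQ _ hpQ (hA _ htA)
      · ext z
        simp only [hP, Finset.coe_union, Set.mem_inter_iff, Set.mem_union, Finset.mem_coe,
          Set.mem_insert_iff, Set.mem_singleton_iff]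
        constructor
        · rintro ⟨hz, hzQ | hzA⟩
          · exact Or.inl (hio z hzQ hz)
          · exact Or.inr (hC.eq_or_eq_of_mem_line hL hst hs ht hz (hA _ hsA) (hA _ htA)
              (hA _ hzA))
        · rintro (rfl | rfl | rfl)
          · exact ⟨hp, Or.inl hpQ⟩
          · exact ⟨hs, Or.inr hsA⟩
          · exact ⟨ht, Or.inr htA⟩
    · intro C _
      rcases Finset.eq_empty_or_nonempty
        (((Q ×ˢ A.offDiag).filter ordinary).filter (circ · = C)) with h | ⟨⟨p, s, t⟩, hi⟩
      · rw [h]; simp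
      refine (Finset.card_le_card (t := {(p, s, t), (p, t, s)}) ?_).trans Finset.card_le_two
      rintro ⟨p', s', t'⟩ hi'
      rw [Finset.mem_filter, Finset.mem_filter] at hi hi'
      obtain ⟨⟨hi, hio⟩, rfl⟩ := hi
      obtain ⟨⟨hi', -⟩, hCC⟩ := hi'
      obtain ⟨hC, hp, hs, ht⟩ := hcirc _ hi
      obtain ⟨-, hp', hs', ht'⟩ := hcirc _ hi'
      rw [hCC] at hp' hs' ht'
      simp only [Finset.mem_product, Finset.mem_offDiag] at hi hi'
      obtain ⟨hpQ, hsA, htA, hst⟩ := hi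
      obtain ⟨hpQ', hsA', htA', hst'⟩ := hi'
      have h1 : p' = p := hio p' hpQ' hp'
      have h2 := hC.eq_or_eq_of_mem_line hL hst hs ht hs' (hA _ hsA) (hA _ htA) (hA _ hsA')
      have h3 := hC.eq_or_eq_of_mem_line hL hst hs ht ht' (hA _ hsA) (hA _ htA) (hA _ htA')
      simp only [Finset.mem_insert, Finset.mem_singleton, Prod.mk.injEq]
      grind
  · have hq : ∀ i : ℂ × ℂ × ℂ, ∃ q, ¬ ordinary i → q ∈ Q ∧ q ∈ circ i ∧ q ≠ i.1 := by
      intro i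
      by_cases h : ordinary i
      · exact ⟨0, fun h' => absurd h h'⟩
      · have h' := h
        simp only [hord, not_forall] at h'
        obtain ⟨q, h1, h2, h3⟩ := h'
        exact ⟨q, fun _ => ⟨h1, h2, h3⟩⟩
    choose other hother using hq
    refine Finset.card_le_card_of_injOn (fun i => ((i.1, other i), i.2.1)) ?_ ?_
    · rintro ⟨p, s, t⟩ hi
      rw [Finset.mem_coe, Finset.mem_filter] at hi
      obtain ⟨hi, hio⟩ := hi
      obtain ⟨h1, h2, h3⟩ := hother _ hio
      simp only [Finset.mem_product, Finset.mem_offDiag] at hi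
      simp only [Finset.mem_coe, Finset.mem_product, Finset.mem_offDiag]
      exact ⟨⟨hi.1, h1, h3.symm⟩, hi.2.1⟩
    · rintro ⟨p, s, t⟩ hi ⟨p', s', t'⟩ hi' heq
      rw [Finset.mem_coe, Finset.mem_filter] at hi hi'
      obtain ⟨hi, hio⟩ := hi
      obtain ⟨hi', hio'⟩ := hi'
      obtain ⟨hC, hp, hs, ht⟩ := hcirc _ hi
      obtain ⟨hC', hp', hs', ht'⟩ := hcirc _ hi'
      obtain ⟨hqQ, hq, hqp⟩ := hother _ hio
      obtain ⟨-, hq', -⟩ := hother _ hio'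
      simp only [Prod.mk.injEq] at heq
      obtain ⟨⟨rfl, hqq⟩, rfl⟩ := heq
      rw [← hqq] at hq'
      simp only [Finset.mem_product, Finset.mem_offDiag] at hi hi'
      obtain ⟨hpQ, hsA, htA, hst⟩ := hi
      obtain ⟨-, -, htA', hst'⟩ := hi'
      have hCC := hC.eq_of_three_mem hC' hqp
        (ne_of_mem_of_not_mem (hA _ hsA) (hQ _ hqQ)).symm
        (ne_of_mem_of_not_mem (hA _ hsA) (hQ _ hpQ)).symm
        hq hp hs hq' hp' hs'
      rw [← hCC] at ht'
      rcases hC.eq_or_eq_of_mem_line hL hst hs ht ht' (hA _ hsA) (hA _ htA) (hA _ htA') with h | h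
      · exact absurd h.symm hst'
      · exact congrArg (fun u => (p, s, u)) h.symm

/-- If all but `K` points of an `n`-point set lie on a line (with `K ≥ 1` and
`n ≥ 2K + 4`), then the set spans at least `(n−1)(n−2)/2` ordinary circles. -/
theorem ordinary_circles_near_line (K n : ℕ) (hK : 1 ≤ K) (hn : 2 * K + 4 ≤ n)
    (P : Finset ℂ) (hP : P.card = n)
    (hline : ∃ L : Set ℂ, IsLine L ∧ ((P : Set ℂ) ∩ L).ncard = n - K) :
    (n - 1) * (n - 2) / 2 ≤ ordinaryCircles (P : Set ℂ) := by
  classical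
  obtain ⟨L, hL, hcard⟩ := hline
  have hA : (P.filter (· ∈ L)).card = n - K := by
    rw [← hcard, ← Set.ncard_coe_finset, Finset.coe_filter]
    rfl
  have hQ : (P.filter (· ∉ L)).card = K := by
    have := Finset.card_filter_add_card_filter_not (s := P) (· ∈ L)
    omega
  have key := card_mul_le_two_mul_ordinaryCircles hL (P.filter (· ∉ L)) (P.filter (· ∈ L))
    (fun p hp => (Finset.mem_filter.1 hp).2) (fun p hp => (Finset.mem_filter.1 hp).2)
  have hunion : P.filter (· ∉ L) ∪ P.filter (· ∈ L) = P := by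
    rw [Finset.union_comm]
    exact Finset.filter_union_filter_not_eq _ P
  rw [hunion, Finset.card_product, Finset.card_product, Finset.offDiag_card, Finset.offDiag_card,
    hA, hQ] at key
  refine Nat.div_le_of_le_mul (le_of_add_le_add_right (le_trans ?_ key))
  obtain ⟨k, rfl⟩ := Nat.exists_eq_add_of_le hK
  obtain ⟨t, rfl⟩ := Nat.exists_eq_add_of_le hn
  have e1 : 2 * (1 + k) + 4 + t - 1 = 2 * k + 5 + t := by omega
  have e2 : 2 * (1 + k) + 4 + t - 2 = 2 * k + 4 + t := by omega
  have e3 : 2 * (1 + k) + 4 + t - (1 + k) = k + 4 + t + 1 := by omega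
  have e4 : ∀ m : ℕ, (m + 1) * (m + 1) - (m + 1) = (m + 1) * m := fun m => by
    rw [← Nat.mul_sub_one, Nat.add_sub_cancel]
  rw [e1, e2, e3, add_comm 1 k, e4, e4]
  nlinarith [Nat.zero_le (k * k * t), Nat.zero_le (k * t), Nat.zero_le (k * t * t)]
end
end
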